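/- There exist constants c, c' > 0 depending only on d ≥ 3 such that for every integer L ≥ 1 and every integer K ≥ max(c,100), setting D = D_0, Ď = Ď_0 = ℤ^d ∩ [−4L,5L)^d and Ǔ = Ǔ_0 = ℤ^d ∩ [−(K+1)L+1,(K+1)L−1)^d, one has cap(D)/cap(Ď) ≥ P_{ē_Ď}[H_D < T_Ǔ] ≥ cap(D)/cap(Ď) − c/K^{d−2} ≥ (cap(D)/cap(Ď))·(1 − c'/K^{d−2}). -/

import Mathlib

open MeasureTheory ENNReal Set
open scoped Classical NNReal

namespace Disconnection

/-- Points of `ℤ^d`. -/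
abbrev Zd (d : ℕ) := Fin d → ℤ

/-- Step distribution of the simple random walk: uniform weight `1/(2d)` on each of the
`2d` unit vectors of `ℤ^d`. -/
noncomputable def stepP (d : ℕ) (v : Zd d) : ℝ≥0∞ :=
  if (∑ i, (v i).natAbs) = 1 then ((2 * d : ℕ) : ℝ≥0∞)⁻¹ else 0

/-- The exponential distribution of rate `1` on `[0,∞)` (as a measure on `ℝ`). -/
noncomputable def expMeasure : Measure ℝ :=
  MeasureTheory.volume.withDensity fun t => ENNReal.ofReal (if 0 < t then Real.exp (-t) else 0)

/-- Nearest neighbours in `ℤ^d` (Euclidean distance one). -/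
def adjacent {d : ℕ} (x y : Zd d) : Prop := (∑ i, (x i - y i).natAbs) = 1

/-- (Outer) boundary `∂A` of a set `A ⊆ ℤ^d`. -/
def bdry {d : ℕ} (A : Set (Zd d)) : Set (Zd d) := {y | y ∉ A ∧ ∃ x ∈ A, adjacent x y}

/-- sup-norm distance between two points of `ℤ^d`. -/
def supDist {d : ℕ} (x y : Zd d) : ℕ := Finset.univ.sup fun i => (x i - y i).natAbs

/-- closed sup-norm ball `B(x,r)` in `ℤ^d`. -/
def ball {d : ℕ} (x : Zd d) (r : ℕ) : Set (Zd d) := {y | supDist x y ≤ r}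

/-- mutual sup-norm distance between two sets. -/
noncomputable def setDist {d : ℕ} (A B : Set (Zd d)) : ℕ := sInf {n | ∃ x ∈ A, ∃ y ∈ B, supDist x y = n}

/-- the box `ℤ^d ∩ [a,b)^d`. -/
def intBox {d : ℕ} (a b : ℤ) : Set (Zd d) := {y | ∀ i, a ≤ y i ∧ y i < b}

/-- A box in `ℤ^d`: a translate of `[0,L)^d ∩ ℤ^d` with `L ≥ 1`. -/
def isBox {d : ℕ} (S : Set (Zd d)) : Prop :=
  ∃ L : ℕ, 1 ≤ L ∧ ∃ a : Zd d, S = {y | ∀ i, a i ≤ y i ∧ y i < a i + L}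

/-- connectedness of a subset of `ℤ^d` by nearest-neighbour paths. -/
def connSet {d : ℕ} (S : Set (Zd d)) : Prop :=
  ∀ a ∈ S, ∀ b ∈ S, ∃ (n : ℕ) (f : ℕ → Zd d), f 0 = a ∧ f n = b ∧
    (∀ k ≤ n, f k ∈ S) ∧ ∀ k < n, adjacent (f k) (f (k + 1))

/-- Euclidean norm of a lattice point. -/
noncomputable def eucNorm {d : ℕ} (x : Zd d) : ℝ := Real.sqrt (∑ i, ((x i : ℝ)) ^ 2)

/-- A model of the continuous-time simple random walk on `ℤ^d` with unit jump rate: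
`Y` is the discrete jump chain and `ζ` are the holding times; under `P x` one has
`Y 0 = x` a.s., and the increments of `Y` together with the holding times are mutually
independent, the increments uniform on the `2d` unit vectors and the holding times
exponential of rate `1`.  This is expressed through the finite-dimensional cylinder
probabilities, which determine the joint law. -/
structure SRW (d : ℕ) (Ω : Type*) [MeasurableSpace Ω] where
  P : Zd d → Measure Ω
  isProb : ∀ x, IsProbabilityMeasure (P x)
  Y : ℕ → Ω → Zd d
  ζ : ℕ → Ω → ℝ
  measurable_Y : ∀ n, Measurable (Y n)
  measurable_ζ : ∀ n, Measurable (ζ n)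
  Y_zero : ∀ x : Zd d, P x {ω | Y 0 ω = x} = 1
  law : ∀ (x : Zd d) (n : ℕ) (s : Fin n → Zd d) (I : Fin n → Set ℝ),
    (∀ i, MeasurableSet (I i)) →
    P x {ω | (∀ i : Fin n, Y ((i : ℕ) + 1) ω - Y (i : ℕ) ω = s i) ∧
             (∀ i : Fin n, ζ (i : ℕ) ω ∈ I i)}
      = (∏ i, stepP d (s i)) * ∏ i, expMeasure (I i)

namespace SRW

variable {d : ℕ} {Ω : Type*} [MeasurableSpace Ω]

/-- time of the `n`-th jump. -/
noncomputable def S (W : SRW d Ω) (n : ℕ) (ω : Ω) : ℝ := ∑ i ∈ Finset.range n, W.ζ i ω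

/-- index of the current step of the jump chain at time `t`. -/
noncomputable def jumpIdx (W : SRW d Ω) (t : ℝ) (ω : Ω) : ℕ := sSup {k : ℕ | W.S k ω ≤ t}

/-- the continuous-time walk `X_t`. -/
noncomputable def X (W : SRW d Ω) (t : ℝ) (ω : Ω) : Zd d := W.Y (W.jumpIdx t ω) ω

/-- entrance time of `A` after time `t` (`∞` if there is none). -/
noncomputable def hitFrom (W : SRW d Ω) (A : Set (Zd d)) (t : ℝ≥0∞) (ω : Ω) : ℝ≥0∞ :=
  sInf {u : ℝ≥0∞ | ∃ s : ℝ≥0, u = (s : ℝ≥0∞) ∧ t ≤ u ∧ W.X (s : ℝ) ω ∈ A}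

/-- entrance time `H_A = inf {t ≥ 0 : X_t ∈ A}`. -/
noncomputable def hit (W : SRW d Ω) (A : Set (Zd d)) (ω : Ω) : ℝ≥0∞ := W.hitFrom A 0 ω

/-- exit time `T_U = inf {t ≥ 0 : X_t ∉ U}`. -/
noncomputable def exit (W : SRW d Ω) (U : Set (Zd d)) (ω : Ω) : ℝ≥0∞ := W.hit Uᶜ ω

/-- hitting time `H̃_A = inf {t ≥ ζ₀ : X_t ∈ A}`. -/
noncomputable def hitTilde (W : SRW d Ω) (A : Set (Zd d)) (ω : Ω) : ℝ≥0∞ :=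
  W.hitFrom A (ENNReal.ofReal (W.ζ 0 ω)) ω

/-- the walk evaluated at a random (possibly infinite) time. -/
noncomputable def Xat (W : SRW d Ω) (τ : Ω → ℝ≥0∞) (ω : Ω) : Zd d := W.X (τ ω).toReal ω

/-- equilibrium measure `e_A(x) = P_x[H̃_A = ∞] 1_A(x)`. -/
noncomputable def eqm (W : SRW d Ω) (A : Set (Zd d)) (x : Zd d) : ℝ :=
  if x ∈ A then (W.P x {ω | W.hitTilde A ω = ⊤}).toReal else 0

/-- capacity `cap(A) = Σ_x e_A(x)`. -/
noncomputable def cap (W : SRW d Ω) (A : Set (Zd d)) : ℝ := ∑ᶠ x, W.eqm A x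

/-- normalized equilibrium measure `ē_A = e_A / cap(A)`. -/
noncomputable def ebar (W : SRW d Ω) (A : Set (Zd d)) (x : Zd d) : ℝ := W.eqm A x / W.cap A

/-- equilibrium measure of `A` relative to `U`: `e_{A,U}(x) = P_x[H̃_A > T_U] 1_A(x)`. -/
noncomputable def eqmRel (W : SRW d Ω) (A U : Set (Zd d)) (x : Zd d) : ℝ :=
  if x ∈ A then (W.P x {ω | W.exit U ω < W.hitTilde A ω}).toReal else 0

/-- `P_ρ = Σ_x ρ(x) P_x`, the walk started from the initial (sub-)measure with density `ρ`. -/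
noncomputable def Pinit (W : SRW d Ω) (ρ : Zd d → ℝ) : Measure Ω :=
  Measure.sum fun x : Zd d => ENNReal.ofReal (ρ x) • W.P x

/-- Green function `g(x,y) = E_x[∫₀^∞ 1{X_s = y} ds]`. -/
noncomputable def green (W : SRW d Ω) (x y : Zd d) : ℝ :=
  ∫ ω, (∫ s in Set.Ioi (0 : ℝ), if W.X s ω = y then (1 : ℝ) else 0) ∂ W.P x

/-- killed Green function `g_U(x,y) = E_x[∫₀^{T_U} 1{X_s = y} ds]`. -/
noncomputable def greenK (W : SRW d Ω) (U : Set (Zd d)) (x y : Zd d) : ℝ :=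
  ∫ ω, (∫ s in Set.Ioi (0 : ℝ),
      if ENNReal.ofReal s < W.exit U ω ∧ W.X s ω = y then (1 : ℝ) else 0) ∂ W.P x

/-- the potential operator `Gf(x) = Σ_y g(x,y) f(y)`. -/
noncomputable def Gop (W : SRW d Ω) (f : Zd d → ℝ) (x : Zd d) : ℝ :=
  ∑ᶠ y, W.green x y * f y

/-- successive return times to `A` (between excursions out of `U`): `Rt A U 0 = R₁ = H_A`. -/
noncomputable def Rt (W : SRW d Ω) (A U : Set (Zd d)) : ℕ → Ω → ℝ≥0∞
  | 0 => W.hit A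
  | k + 1 => fun ω => W.hitFrom A (W.hitFrom Uᶜ (W.Rt A U k ω) ω) ω

/-- successive departure times from `U`: `Dt A U k = D_{k+1}`. -/
noncomputable def Dt (W : SRW d Ω) (A U : Set (Zd d)) (k : ℕ) (ω : Ω) : ℝ≥0∞ :=
  W.hitFrom Uᶜ (W.Rt A U k ω) ω

/-- number of excursions from `A` to the complement of `U`:
`N_{A,U} = sup {k ≥ 1 : D_k < ∞}` (with `sup ∅ = 0`). -/
noncomputable def Nexc (W : SRW d Ω) (A U : Set (Zd d)) (ω : Ω) : ℕ :=
  sSup {n | 0 < n ∧ W.Dt A U (n - 1) ω < ⊤}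

end SRW

end Disconnection

open Disconnection

namespace Disc12

open Filter Topology

/-! ### Analytic part -/

lemma mvt_aux {G G' : ℝ → ℝ} (h0 : G 0 = 0)
    (hG : ∀ t, |t| ≤ 1/2 → HasDerivAt G (G' t) t) (t : ℝ) (ht : |t| ≤ 1/2) (ht0 : t ≠ 0) :
    ∃ c, |c| ≤ 1/2 ∧ 0 < c * t ∧ G t = G' c * t := by
  rw [abs_le] at ht
  rcases lt_or_gt_of_ne ht0 with h | h
  · have hI : ∀ x, x ∈ Icc t 0 → |x| ≤ 1/2 := by
      intro x hx; rw [abs_le]; constructor <;> linarith [hx.1, hx.2]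
    obtain ⟨c, hc, he⟩ := exists_hasDerivAt_eq_slope G G' h
      (fun x hx => (hG x (hI x hx)).continuousAt.continuousWithinAt)
      (fun x hx => hG x (hI x ⟨hx.1.le, hx.2.le⟩))
    refine ⟨c, hI c ⟨hc.1.le, hc.2.le⟩, by nlinarith [hc.1, hc.2], ?_⟩
    rw [he, h0]; field_simp; ring
  · have hI : ∀ x, x ∈ Icc 0 t → |x| ≤ 1/2 := by
      intro x hx; rw [abs_le]; constructor <;> linarith [hx.1, hx.2]
    obtain ⟨c, hc, he⟩ := exists_hasDerivAt_eq_slope G G' h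
      (fun x hx => (hG x (hI x hx)).continuousAt.continuousWithinAt)
      (fun x hx => hG x (hI x ⟨hx.1.le, hx.2.le⟩))
    refine ⟨c, hI c ⟨hc.1.le, hc.2.le⟩, by nlinarith [hc.1, hc.2], ?_⟩
    rw [he, h0]; field_simp; ring

lemma helpA {G G' : ℝ → ℝ} (h0 : G 0 = 0)
    (hG : ∀ t, |t| ≤ 1/2 → HasDerivAt G (G' t) t) (hp : ∀ t, |t| ≤ 1/2 → 0 ≤ G' t) :
    ∀ t, |t| ≤ 1/2 → 0 ≤ t * G t := by
  intro t ht
  by_cases ht0 : t = 0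
  · simp [ht0]
  obtain ⟨c, hc, _, he⟩ := mvt_aux h0 hG t ht ht0
  rw [he]; nlinarith [mul_nonneg (hp c hc) (sq_nonneg t)]

lemma helpB {G G' : ℝ → ℝ} (h0 : G 0 = 0)
    (hG : ∀ t, |t| ≤ 1/2 → HasDerivAt G (G' t) t) (hp : ∀ t, |t| ≤ 1/2 → 0 ≤ t * G' t) :
    ∀ t, |t| ≤ 1/2 → 0 ≤ G t := by
  intro t ht
  by_cases ht0 : t = 0
  · simp [ht0, h0]
  obtain ⟨c, hc, hct, he⟩ := mvt_aux h0 hG t ht ht0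
  rw [he]
  have h1 := hp c hc
  have hc0 : c ≠ 0 := by rintro rfl; simp at hct
  have hc2 : 0 < c ^ 2 := by positivity
  by_contra hneg
  push Not at hneg
  have : (c * G' c) * (c * t) = c ^ 2 * (G' c * t) := by ring
  nlinarith [mul_nonneg h1 hct.le, mul_pos hc2 (neg_pos.2 hneg)]

lemma hasDeriv_pw (β : ℝ) (t : ℝ) (ht : |t| ≤ 1/2) :
    HasDerivAt (fun t : ℝ => (1 + t) ^ (-β)) (-β * (1 + t) ^ (-(β + 1))) t := by
  rw [abs_le] at ht
  have h : HasDerivAt (fun t : ℝ => 1 + t) 1 t := (hasDerivAt_id t).const_add 1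
  have := h.rpow_const (p := -β) (Or.inl (by linarith))
  convert this using 1
  rw [show -(β + 1) = -β - 1 by ring]; ring

lemma taylor4 (α : ℝ) (hα : 0 < α) : ∃ C : ℝ, 0 ≤ C ∧ ∀ t : ℝ, |t| ≤ 1/2 →
    (1 + t) ^ (-α) ≤ 1 - α * t + α * (α + 1) / 2 * t ^ 2
      - α * (α + 1) * (α + 2) / 6 * t ^ 3 + C * t ^ 4 := by
  set M : ℝ := α * (α + 1) * (α + 2) * (α + 3) * (1 / 2 : ℝ) ^ (-(α + 4)) with hM
  have hM0 : 0 ≤ M := by positivity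
  refine ⟨M / 24, by positivity, ?_⟩
  have e4 : ∀ t : ℝ, |t| ≤ 1/2 →
      0 ≤ M - α * (α + 1) * (α + 2) * (α + 3) * (1 + t) ^ (-(α + 4)) := by
    intro t ht
    rw [abs_le] at ht
    have : (1 + t) ^ (-(α + 4)) ≤ (1 / 2 : ℝ) ^ (-(α + 4)) :=
      Real.rpow_le_rpow_of_nonpos (by norm_num) (by linarith) (by linarith)
    have := mul_le_mul_of_nonneg_left this
      (show 0 ≤ α * (α + 1) * (α + 2) * (α + 3) by positivity)
    linarith
  have e3 := helpA (G := fun t => α * (α + 1) * (α + 2) * (1 + t) ^ (-(α + 3))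
      - α * (α + 1) * (α + 2) + M * t) (by simp) (fun t ht => by
        have h1 := ((hasDeriv_pw (α + 3) t ht).const_mul (α * (α + 1) * (α + 2))).sub_const
          (α * (α + 1) * (α + 2))
        have h2 := h1.add ((hasDerivAt_id t).const_mul M)
        refine h2.congr_deriv ?_
        rw [show α + 3 + 1 = α + 4 by ring]
        ring) e4
  have e2 := helpB (G := fun t => - (α * (α + 1)) * (1 + t) ^ (-(α + 2))
      + α * (α + 1) - α * (α + 1) * (α + 2) * t + M / 2 * t ^ 2) (by simp) (fun t ht => by
        have h1 := ((hasDeriv_pw (α + 2) t ht).const_mul (-(α * (α + 1)))).add_const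
          (α * (α + 1))
        have h2 := (h1.sub ((hasDerivAt_id t).const_mul (α * (α + 1) * (α + 2)))).add
          ((hasDerivAt_pow 2 t).const_mul (M / 2))
        refine h2.congr_deriv ?_
        rw [show α + 2 + 1 = α + 3 by ring]
        push_cast
        ring) e3
  have e1 := helpA (G := fun t => α * (1 + t) ^ (-(α + 1))
      - α + α * (α + 1) * t - α * (α + 1) * (α + 2) / 2 * t ^ 2 + M / 6 * t ^ 3)
      (by simp) (fun t ht => by
        have h1 := ((hasDeriv_pw (α + 1) t ht).const_mul α).sub_const α
        have h2 := ((h1.add ((hasDerivAt_id t).const_mul (α * (α + 1)))).sub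
          ((hasDerivAt_pow 2 t).const_mul (α * (α + 1) * (α + 2) / 2))).add
          ((hasDerivAt_pow 3 t).const_mul (M / 6))
        refine h2.congr_deriv ?_
        rw [show α + 1 + 1 = α + 2 by ring]
        push_cast
        ring) e2
  have e0 := helpB (G := fun t => - (1 + t) ^ (-α)
      + 1 - α * t + α * (α + 1) / 2 * t ^ 2 - α * (α + 1) * (α + 2) / 6 * t ^ 3
      + M / 24 * t ^ 4)
      (by simp) (fun t ht => by
        have h1 := ((hasDeriv_pw α t ht).neg).add_const 1
        have h2 := (((h1.sub ((hasDerivAt_id t).const_mul α)).add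
          ((hasDerivAt_pow 2 t).const_mul (α * (α + 1) / 2))).sub
          ((hasDerivAt_pow 3 t).const_mul (α * (α + 1) * (α + 2) / 6))).add
          ((hasDerivAt_pow 4 t).const_mul (M / 24))
        refine h2.congr_deriv ?_
        push_cast
        ring) e1
  intro t ht
  have := e0 t ht
  beta_reduce at this
  linarith

variable {d : ℕ}

/-- unit steps -/
def stp (b : Fin d × Bool) : Zd d := if b.2 then Pi.single b.1 1 else - Pi.single b.1 1

/-- averaging operator -/
noncomputable def Pop (f : Zd d → ℝ) (x : Zd d) : ℝ := (∑ b : Fin d × Bool, f (x + stp b)) / (2 * d)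

/-- squared norm -/
noncomputable def nsq (x : Zd d) : ℝ := ∑ i, (x i : ℝ) ^ 2

/-- superharmonic function -/
noncomputable def sh (d : ℕ) (a : ℝ) (x : Zd d) : ℝ := (nsq x + a) ^ (-(((d : ℝ) - 2) / 2))

lemma nsq_nonneg (x : Zd d) : 0 ≤ nsq x := Finset.sum_nonneg fun _ _ => sq_nonneg _

lemma sq_le_nsq (x : Zd d) (i : Fin d) : (x i : ℝ) ^ 2 ≤ nsq x :=
  Finset.single_le_sum (f := fun i => (x i : ℝ) ^ 2) (fun _ _ => sq_nonneg _) (Finset.mem_univ i)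

lemma nsq_step (x : Zd d) (i : Fin d) (σ : ℤ) :
    nsq (x + σ • (Pi.single i 1 : Zd d)) = nsq x + ((σ : ℝ) ^ 2 + 2 * σ * x i) := by
  unfold nsq
  rw [← sub_eq_iff_eq_add', ← Finset.sum_sub_distrib]
  rw [Finset.sum_eq_single i]
  · simp; ring
  · intro j _ hj; simp [Pi.single_eq_of_ne hj]
  · simp

lemma nsq_stp (x : Zd d) (i : Fin d) :
    nsq (x + stp (i, true)) = nsq x + (1 + 2 * x i) ∧
    nsq (x + stp (i, false)) = nsq x + (1 - 2 * x i) := by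
  have h1 := nsq_step x i 1
  have h2 := nsq_step x i (-1)
  constructor
  · simp [stp] at h1 ⊢; linarith
  · simp [stp] at h2 ⊢; linarith

lemma exists_sh (hd : 3 ≤ d) : ∃ a : ℝ, 1 ≤ a ∧ ∀ x : Zd d, Pop (sh d a) x ≤ sh d a x := by
  have hd' : (3 : ℝ) ≤ d := by exact_mod_cast hd
  set α : ℝ := ((d : ℝ) - 2) / 2 with hα
  have hα0 : 0 < α := by rw [hα]; linarith
  obtain ⟨C, hC, hT⟩ := taylor4 α hα0
  set β : ℝ := α * (α + 1) / 2 with hβ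
  have hβ0 : 0 < β := by positivity
  set a : ℝ := max 6 ((2 * β * d + 32 * C * d) / (8 * β)) with ha
  have ha6 : 6 ≤ a := le_max_left _ _
  have ha8 : 2 * β * d + 32 * C * d ≤ 8 * β * a := by
    have := le_max_right 6 ((2 * β * d + 32 * C * d) / (8 * β))
    rw [← ha, div_le_iff₀ (by positivity)] at this
    linarith
  refine ⟨a, by linarith, fun x => ?_⟩
  set N := nsq x with hN
  have hN0 : 0 ≤ N := nsq_nonneg x
  set s := N + a with hs
  have hs0 : 0 < s := by linarith
  have key : ∀ i, sh d a (x + stp (i, true)) + sh d a (x + stp (i, false)) ≤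
      s ^ (-α) * (2 - 2 * α / s + 2 * β * (1 + 4 * (x i : ℝ) ^ 2) / s ^ 2 + 32 * C / s ^ 2) := by
    intro i
    have hx : (x i : ℝ) ^ 2 ≤ N := sq_le_nsq x i
    set u : ℝ := (x i : ℝ) with hu
    have hb : ∀ v : ℝ, v ^ 2 = u ^ 2 → |(1 + 2 * v) / s| ≤ 1/2 := by
      intro v hv
      rw [abs_div, abs_of_pos hs0, div_le_iff₀ hs0, abs_le]
      constructor <;> nlinarith [sq_nonneg (v - 2), sq_nonneg (v + 2)]
    have hf : ∀ v : ℝ, v ^ 2 = u ^ 2 → (N + (1 + 2 * v) + a) ^ (-α) ≤ s ^ (-α) *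
        (1 - α * ((1 + 2 * v) / s) + β * ((1 + 2 * v) / s) ^ 2
      - α * (α + 1) * (α + 2) / 6 * ((1 + 2 * v) / s) ^ 3 + C * ((1 + 2 * v) / s) ^ 4) := by
      intro v hv
      have h1 := hb v hv
      have h2 := hT _ h1
      rw [abs_le] at h1
      rw [show N + (1 + 2 * v) + a = s * (1 + (1 + 2 * v) / s) by field_simp; ring]
      rw [Real.mul_rpow hs0.le (by linarith)]
      exact mul_le_mul_of_nonneg_left h2 (by positivity)
    have h1 := hf u rfl
    have h2 := hf (-u) (by ring)
    have e1 : sh d a (x + stp (i, true)) = (N + (1 + 2 * u) + a) ^ (-α) := by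
      unfold sh; rw [(nsq_stp x i).1]
    have e2 : sh d a (x + stp (i, false)) = (N + (1 + 2 * (-u)) + a) ^ (-α) := by
      unfold sh; rw [(nsq_stp x i).2]; congr 1; ring
    rw [e1, e2]
    refine (add_le_add h1 h2).trans ?_
    rw [← mul_add]
    refine mul_le_mul_of_nonneg_left ?_ (by positivity)
    have h3 : 0 ≤ α * (α + 1) * (α + 2) / 6 * (((1 + 2 * u) / s) ^ 3 + ((1 + 2 * -u) / s) ^ 3) := by
      apply mul_nonneg (by positivity)
      rw [show ((1 + 2 * u) / s) ^ 3 + ((1 + 2 * -u) / s) ^ 3 = (2 + 24 * u ^ 2) / s ^ 3 by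
        field_simp; ring]
      positivity
    have h4 : C * (((1 + 2 * u) / s) ^ 4 + ((1 + 2 * -u) / s) ^ 4) ≤ 32 * C / s ^ 2 := by
      rw [show ((1 + 2 * u) / s) ^ 4 + ((1 + 2 * -u) / s) ^ 4 =
        (2 + 48 * u ^ 2 + 32 * u ^ 4) / s ^ 4 by field_simp; ring]
      rw [show 32 * C / s ^ 2 = C * (32 * s ^ 2 / s ^ 4) by field_simp]
      apply mul_le_mul_of_nonneg_left _ hC
      gcongr
      have : 1 + u ^ 2 ≤ s := by linarith
      nlinarith [sq_nonneg u]
    have h5 : 2 - 2 * α / s + 2 * β * (1 + 4 * u ^ 2) / s ^ 2 =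
        (1 - α * ((1 + 2 * u) / s) + β * ((1 + 2 * u) / s) ^ 2) +
        (1 - α * ((1 + 2 * -u) / s) + β * ((1 + 2 * -u) / s) ^ 2) := by
      field_simp; ring
    rw [h5]
    linarith
  unfold Pop
  rw [div_le_iff₀ (by positivity), Fintype.sum_prod_type]
  simp only [Fintype.sum_bool]
  refine (Finset.sum_le_sum fun i _ => key i).trans ?_
  rw [← Finset.mul_sum]
  change _ ≤ s ^ (-α) * _
  refine mul_le_mul_of_nonneg_left ?_ (by positivity)
  have e : ∑ i : Fin d, (2 - 2 * α / s + 2 * β * (1 + 4 * (x i : ℝ) ^ 2) / s ^ 2 + 32 * C / s ^ 2)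
      = 2 * d - 2 * α * d / s + 2 * β * (d + 4 * N) / s ^ 2 + 32 * C * d / s ^ 2 := by
    rw [Finset.sum_add_distrib, Finset.sum_add_distrib, ← Finset.sum_div, ← Finset.mul_sum,
      Finset.sum_add_distrib, ← Finset.mul_sum]
    simp [hN, nsq]; ring
  rw [e]
  have hNs : N = s - a := by rw [hs]; ring
  have h8 : 8 * β = 2 * α * d := by
    rw [hβ, show (d : ℝ) = 2 * (α + 1) by rw [hα]; ring]; ring
  have : 2 * d - 2 * α * d / s + 2 * β * (d + 4 * N) / s ^ 2 + 32 * C * d / s ^ 2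
     = 2 * d + (2 * β * d + 32 * C * d - 8 * β * a) / s ^ 2 := by
    rw [hNs, ← h8]; field_simp; ring
  rw [this]
  have : (2 * β * d + 32 * C * d - 8 * β * a) / s ^ 2 ≤ 0 :=
    div_nonpos_of_nonpos_of_nonneg (by linarith) (by positivity)
  linarith

/-! ### Potential theory for the averaging operator -/

lemma Pop_mono {f g : Zd d → ℝ} (h : ∀ x, f x ≤ g x) (x : Zd d) : Pop f x ≤ Pop g x := by
  unfold Pop
  gcongr
  exact h _

lemma Pop_const (hd : 3 ≤ d) (c : ℝ) (x : Zd d) : Pop (fun _ => c) x = c := by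
  unfold Pop
  have : (d : ℝ) ≠ 0 := by positivity
  simp
  field_simp

lemma Pop_smul (c : ℝ) (f : Zd d → ℝ) (x : Zd d) : Pop (fun y => c * f y) x = c * Pop f x := by
  unfold Pop
  rw [← Finset.mul_sum, mul_div_assoc]

lemma Pop_add (f g : Zd d → ℝ) (x : Zd d) : Pop (fun y => f y + g y) x = Pop f x + Pop g x := by
  unfold Pop
  rw [Finset.sum_add_distrib, add_div]

lemma Pop_nonneg {f : Zd d → ℝ} (h : ∀ x, 0 ≤ f x) (x : Zd d) : 0 ≤ Pop f x := by
  unfold Pop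
  exact div_nonneg (Finset.sum_nonneg fun _ _ => h _) (by positivity)

lemma Pop_tendsto {F : ℕ → Zd d → ℝ} {f : Zd d → ℝ}
    (h : ∀ x, Tendsto (fun n => F n x) atTop (𝓝 (f x))) (x : Zd d) :
    Tendsto (fun n => Pop (F n) x) atTop (𝓝 (Pop f x)) := by
  unfold Pop
  exact (tendsto_finsetSum _ fun b _ => h _).div_const _

lemma sh_nonneg (a : ℝ) (ha : 1 ≤ a) (x : Zd d) : 0 ≤ sh d a x :=
  Real.rpow_nonneg (by linarith [nsq_nonneg x]) _

lemma sh_pos (a : ℝ) (ha : 1 ≤ a) (x : Zd d) : 0 < sh d a x :=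
  Real.rpow_pos_of_pos (by linarith [nsq_nonneg x]) _

/-- the superharmonic function vanishes at infinity -/
lemma sh_finite (hd : 3 ≤ d) (a : ℝ) (ha : 1 ≤ a) (ε : ℝ) (hε : 0 < ε) :
    {x : Zd d | ε ≤ sh d a x}.Finite := by
  have hd' : (3 : ℝ) ≤ d := by exact_mod_cast hd
  set α : ℝ := ((d : ℝ) - 2) / 2 with hα
  have hα0 : 0 < α := by rw [hα]; linarith
  obtain ⟨M, hM⟩ := exists_nat_gt (ε ^ (-α⁻¹))
  refine (Set.finite_Icc (fun _ => -(M : ℤ)) (fun _ : Fin d => (M : ℤ))).subset ?_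
  intro x hx
  have hs : 0 < nsq x + a := by linarith [nsq_nonneg x]
  have h1 : nsq x + a ≤ ε ^ (-α⁻¹) := by
    have h2 : ε ≤ (nsq x + a) ^ (-α) := hx
    have h3 := Real.rpow_le_rpow_of_nonpos hε h2 (show -α⁻¹ ≤ 0 by
      have := inv_pos.2 hα0; linarith)
    rw [← Real.rpow_mul hs.le] at h3
    simpa [hα0.ne'] using h3
  have h4 : ∀ i, (x i) ^ 2 ≤ (M : ℤ) := by
    intro i
    have : (x i : ℝ) ^ 2 ≤ (M : ℝ) := by linarith [sq_le_nsq x i]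
    exact_mod_cast this
  simp only [Set.mem_Icc, Pi.le_def]
  constructor
  · intro i; nlinarith [h4 i]
  · intro i; nlinarith [h4 i]

/-- maximum principle -/
lemma max_principle (hd : 3 ≤ d) (u : Zd d → ℝ) (hu : ∀ x, u x ≤ Pop u x)
    (hf : ∀ ε > 0, {x | ε ≤ u x}.Finite) (x : Zd d) : u x ≤ 0 := by
  by_contra hx
  push Not at hx
  obtain ⟨y, hy, hmax⟩ := (hf _ hx).exists_maximalFor u _ ⟨x, le_refl (u x)⟩
  have hle : ∀ z, u z ≤ u y := by
    intro z
    by_contra hz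
    push Not at hz
    have := hmax (j := z) (le_trans (show u x ≤ u y from hy) hz.le) hz.le
    linarith
  have hstep : ∀ z, u z = u y → ∀ b, u (z + stp b) = u y := by
    intro z hz b
    by_contra hne
    have hlt : u (z + stp b) < u y := lt_of_le_of_ne (hle _) hne
    have h1 : ∑ b : Fin d × Bool, u (z + stp b) < ∑ b : Fin d × Bool, u y :=
      Finset.sum_lt_sum (fun _ _ => hle _) ⟨b, Finset.mem_univ _, hlt⟩
    have h2 := hu z
    have hd0 : (0 : ℝ) < 2 * d := by positivity
    unfold Pop at h2
    rw [le_div_iff₀ hd0, hz] at h2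
    simp at h1
    linarith
  let i0 : Fin d := ⟨0, by omega⟩
  have hall : ∀ n : ℕ, u (y + n • stp (i0, true)) = u y := by
    intro n
    induction n with
    | zero => simp
    | succ n ih =>
      rw [succ_nsmul, ← add_assoc]
      exact hstep _ ih _
  have hinj : Function.Injective (fun n : ℕ => y + n • stp (i0, true)) := by
    intro m n h
    have := congrFun h i0
    simpa [stp] using this
  refine Set.infinite_of_injective_forall_mem hinj (s := {z | u x ≤ u z}) ?_ (hf _ hx)
  intro n
  show u x ≤ _
  rw [hall]
  exact hy

lemma iter_sh_tendsto (hd : 3 ≤ d) (a : ℝ) (ha : 1 ≤ a)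
    (hsup : ∀ x : Zd d, Pop (sh d a) x ≤ sh d a x) (x : Zd d) :
    Tendsto (fun n => (Pop^[n] (sh d a)) x) atTop (𝓝 0) := by
  have hnn : ∀ n x, 0 ≤ (Pop^[n] (sh d a)) x := by
    intro n
    induction n with
    | zero => exact fun x => sh_nonneg a ha x
    | succ n ih => intro x; rw [Function.iterate_succ_apply']; exact Pop_nonneg ih x
  have hanti : ∀ n x, (Pop^[n+1] (sh d a)) x ≤ (Pop^[n] (sh d a)) x := by
    intro n
    induction n with
    | zero => exact hsup
    | succ n ih =>
      intro x
      have := Pop_mono ih x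
      rwa [← Function.iterate_succ_apply' Pop (n + 1), ← Function.iterate_succ_apply' Pop n] at this
  have ha : ∀ x, Antitone (fun n => (Pop^[n] (sh d a)) x) := fun x =>
    antitone_nat_of_succ_le fun n => hanti n x
  have hbdd : ∀ x, BddBelow (Set.range fun n => (Pop^[n] (sh d a)) x) := fun x =>
    ⟨0, by rintro _ ⟨n, rfl⟩; exact hnn n x⟩
  set u : Zd d → ℝ := fun x => ⨅ n, (Pop^[n] (sh d a)) x with hu
  have ht : ∀ x, Tendsto (fun n => (Pop^[n] (sh d a)) x) atTop (𝓝 (u x)) := fun x =>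
    tendsto_atTop_ciInf (ha x) (hbdd x)
  have hh : ∀ x, Pop u x = u x := by
    intro x
    have h1 := Pop_tendsto ht x
    have h2 := (tendsto_add_atTop_iff_nat 1).2 (ht x)
    simp only [Function.iterate_succ_apply'] at h2
    exact tendsto_nhds_unique h1 h2
  have hle : ∀ x, u x ≤ sh d a x := fun x => ciInf_le (hbdd x) 0
  have h0 : u x ≤ 0 := max_principle hd u (fun x => (hh x).ge)
    (fun ε hε => (sh_finite hd a (by assumption) ε hε).subset fun z hz => le_trans hz (hle z)) x
  have h0' : 0 ≤ u x := le_ciInf fun n => hnn n x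
  have := ht x
  rwa [le_antisymm h0 h0'] at this

lemma iter_mono {f g : Zd d → ℝ} (h : ∀ x, f x ≤ g x) (n : ℕ) (x : Zd d) :
    (Pop^[n] f) x ≤ (Pop^[n] g) x := by
  induction n generalizing x with
  | zero => exact h x
  | succ n ih => rw [Function.iterate_succ_apply', Function.iterate_succ_apply']; exact Pop_mono ih x

lemma iter_smul (c : ℝ) (f : Zd d → ℝ) (n : ℕ) (x : Zd d) :
    (Pop^[n] (fun y => c * f y)) x = c * (Pop^[n] f) x := by
  induction n generalizing x with
  | zero => rfl
  | succ n ih =>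
    rw [Function.iterate_succ_apply', Function.iterate_succ_apply', ← Pop_smul]
    congr 1; funext y; exact ih y

lemma iter_nonneg {f : Zd d → ℝ} (h : ∀ x, 0 ≤ f x) (n : ℕ) (x : Zd d) :
    0 ≤ (Pop^[n] f) x := by
  induction n generalizing x with
  | zero => exact h x
  | succ n ih => rw [Function.iterate_succ_apply']; exact Pop_nonneg ih x

lemma iter_tendsto (hd : 3 ≤ d) {a : ℝ} (ha : 1 ≤ a)
    (hsup : ∀ x : Zd d, Pop (sh d a) x ≤ sh d a x) (h : Zd d → ℝ) (c : ℝ)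
    (h0 : ∀ x, 0 ≤ h x) (hc : ∀ x, h x ≤ c * sh d a x) (x : Zd d) :
    Tendsto (fun n => (Pop^[n] h) x) atTop (𝓝 0) := by
  have h1 := (iter_sh_tendsto hd a ha hsup x).const_mul c
  rw [mul_zero] at h1
  refine squeeze_zero (fun n => iter_nonneg h0 n x) (fun n => ?_) h1
  rw [← iter_smul]
  exact iter_mono hc n x

/-! symmetry -/

lemma stp_neg (b : Fin d × Bool) : stp (b.1, !b.2) = - stp b := by
  rcases b with ⟨i, _ | _⟩ <;> simp [stp]

lemma Pop_support {u : Zd d → ℝ} (hu : (Function.support u).Finite) :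
    (Function.support (Pop u)).Finite := by
  have : (⋃ b : Fin d × Bool, (fun y => y - stp b) '' Function.support u).Finite :=
    Set.finite_iUnion fun b => hu.image _
  refine this.subset ?_
  intro x hx
  by_contra hn
  apply hx
  unfold Pop
  rw [Finset.sum_eq_zero, zero_div]
  intro b _
  by_contra hb
  exact hn (Set.mem_iUnion.2 ⟨b, x + stp b, hb, by simp⟩)

lemma summ_fin {u : Zd d → ℝ} (hu : (Function.support u).Finite) (v : Zd d → ℝ) :
    Summable (fun x => u x * v x) :=
  summable_of_hasFiniteSupport (hu.subset fun x hx h => hx (by simp [h]))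

lemma Pop_symm {u : Zd d → ℝ} (hu : (Function.support u).Finite) (v : Zd d → ℝ) :
    ∑' x, u x * Pop v x = ∑' x, Pop u x * v x := by
  have h1 : ∑' x, u x * Pop v x = (∑ b : Fin d × Bool, ∑' x, u x * v (x + stp b)) / (2 * d) := by
    rw [← Summable.tsum_finsetSum (fun b _ => summ_fin hu fun x => v (x + stp b)), ← tsum_div_const]
    congr 1; funext x
    unfold Pop
    rw [← Finset.mul_sum, mul_div_assoc]
  have hs : ∀ b : Fin d × Bool, (Function.support fun x => u (x + stp b)).Finite := by
    intro b
    refine (hu.image (fun y => y - stp b)).subset ?_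
    intro x hx
    exact ⟨x + stp b, hx, by simp⟩
  have h2 : ∑' x, Pop u x * v x = (∑ b : Fin d × Bool, ∑' x, u (x + stp b) * v x) / (2 * d) := by
    rw [← Summable.tsum_finsetSum (fun b _ => summ_fin (hs b) v), ← tsum_div_const]
    congr 1; funext x
    unfold Pop
    rw [← Finset.sum_mul]; ring
  rw [h1, h2]
  congr 1
  let e : Fin d × Bool ≃ Fin d × Bool := Equiv.prodCongr (Equiv.refl _) Equiv.boolNot
  rw [← Equiv.sum_comp e]
  refine Finset.sum_congr rfl fun b _ => ?_
  have : stp (e b) = - stp b := stp_neg b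
  rw [this, ← (Equiv.addRight (stp b)).tsum_eq]
  simp

lemma iter_symm {u : Zd d → ℝ} (hu : (Function.support u).Finite) (v : Zd d → ℝ) (n : ℕ) :
    ∑' x, u x * (Pop^[n] v) x = ∑' x, (Pop^[n] u) x * v x := by
  induction n generalizing u with
  | zero => rfl
  | succ n ih =>
    rw [Function.iterate_succ_apply', Pop_symm hu, ih (Pop_support hu), Function.iterate_succ_apply]

lemma Pop_sub (f g : Zd d → ℝ) (x : Zd d) : Pop (fun y => f y - g y) x = Pop f x - Pop g x := by
  unfold Pop
  rw [Finset.sum_sub_distrib, sub_div]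

lemma iter_sub (f g : Zd d → ℝ) (n : ℕ) (x : Zd d) :
    (Pop^[n] (fun y => f y - g y)) x = (Pop^[n] f) x - (Pop^[n] g) x := by
  induction n generalizing x with
  | zero => rfl
  | succ n ih =>
    rw [Function.iterate_succ_apply', Function.iterate_succ_apply', Function.iterate_succ_apply',
      ← Pop_sub]
    congr 1; funext y; exact ih y

/-- reciprocity -/
lemma recip {e₁ e₂ h₁ h₂ : Zd d → ℝ} (f₁ : (Function.support e₁).Finite)
    (f₂ : (Function.support e₂).Finite)
    (H₁ : ∀ x, e₁ x = h₁ x - Pop h₁ x) (H₂ : ∀ x, e₂ x = h₂ x - Pop h₂ x)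
    (t₁ : ∀ x, Tendsto (fun n => (Pop^[n] h₁) x) atTop (𝓝 0))
    (t₂ : ∀ x, Tendsto (fun n => (Pop^[n] h₂) x) atTop (𝓝 0)) :
    ∑' x, e₁ x * h₂ x = ∑' x, e₂ x * h₁ x := by
  have tel : ∀ {e h : Zd d → ℝ}, (∀ x, e x = h x - Pop h x) → ∀ n x,
      ∑ k ∈ Finset.range n, (Pop^[k] e) x = h x - (Pop^[n] h) x := by
    intro e h H n x
    have he : e = fun x => h x - Pop h x := funext H
    induction n with
    | zero => simp
    | succ n ih =>
      rw [Finset.sum_range_succ, ih, he, iter_sub, ← Function.iterate_succ_apply]; ring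
  have main : ∀ {e e' h : Zd d → ℝ}, (Function.support e).Finite →
      (∀ x, e' x = h x - Pop h x) → (∀ x, Tendsto (fun n => (Pop^[n] h) x) atTop (𝓝 0)) →
      Tendsto (fun n => ∑ k ∈ Finset.range n, ∑' x, e x * (Pop^[k] e') x) atTop
        (𝓝 (∑' x, e x * h x)) := by
    intro e e' h fe H t
    have h1 : ∀ n, ∑ k ∈ Finset.range n, ∑' x, e x * (Pop^[k] e') x =
        ∑ x ∈ fe.toFinset, e x * (h x - (Pop^[n] h) x) := by
      intro n
      rw [← Summable.tsum_finsetSum (fun k _ => summ_fin fe _)]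
      rw [tsum_eq_sum (s := fe.toFinset)]
      · refine Finset.sum_congr rfl fun x _ => ?_
        rw [← Finset.mul_sum, tel H]
      · intro x hx
        have : e x = 0 := by simpa using hx
        simp [this]
    have h2 : ∑' x, e x * h x = ∑ x ∈ fe.toFinset, e x * (h x - 0) := by
      rw [tsum_eq_sum (s := fe.toFinset)]
      · simp
      · intro x hx
        have : e x = 0 := by simpa using hx
        simp [this]
    simp_rw [h1, h2]
    exact tendsto_finsetSum _ fun x _ => (tendsto_const_nhds.sub (t x)).const_mul _
  have m1 := main f₁ H₂ t₂
  have m2 := main f₂ H₁ t₁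
  refine tendsto_nhds_unique m1 (m2.congr fun n => ?_)
  refine Finset.sum_congr rfl fun k _ => ?_
  rw [iter_symm f₂]
  exact tsum_congr fun x => mul_comm _ _

/-! hitting probabilities, recursively -/

/-- probability to hit `D` within `n` steps without leaving `U`. -/
noncomputable def kk (D U : Set (Zd d)) : ℕ → Zd d → ℝ
  | 0, x => if x ∈ U then (if x ∈ D then 1 else 0) else 0
  | n + 1, x => if x ∈ U then (if x ∈ D then 1 else Pop (kk D U n) x) else 0

lemma kk_nonneg (D U : Set (Zd d)) (n : ℕ) (x : Zd d) : 0 ≤ kk D U n x := by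
  induction n generalizing x with
  | zero => unfold kk; split_ifs <;> norm_num
  | succ n ih => unfold kk; split_ifs <;> first | exact Pop_nonneg ih x | norm_num

lemma kk_le_one (hd : 3 ≤ d) (D U : Set (Zd d)) (n : ℕ) (x : Zd d) : kk D U n x ≤ 1 := by
  induction n generalizing x with
  | zero => unfold kk; split_ifs <;> norm_num
  | succ n ih =>
    unfold kk; split_ifs
    · norm_num
    · exact (Pop_mono ih x).trans (Pop_const hd 1 x).le
    · norm_num

lemma kk_mono (hd : 3 ≤ d) (D D' U U' : Set (Zd d)) (h : D ⊆ D') (h' : U ⊆ U') (n : ℕ) (x : Zd d) :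
    kk D U n x ≤ kk D' U' n x := by
  induction n generalizing x with
  | zero =>
    by_cases h1 : x ∈ U
    · by_cases h2 : x ∈ D
      · simp [kk, h1, h2, h h2, h' h1]
      · simpa [kk, h1, h2] using kk_nonneg D' U' 0 x
    · simpa [kk, h1] using kk_nonneg D' U' 0 x
  | succ n ih =>
    by_cases h1 : x ∈ U
    · by_cases h2 : x ∈ D
      · simp [kk, h1, h2, h h2, h' h1]
      · by_cases h3 : x ∈ D'
        · simp only [kk, h1, h2, h3, h' h1, if_true, if_false]
          exact (Pop_mono (fun y => kk_le_one hd D U n y) x).trans (Pop_const hd 1 x).le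
        · simp only [kk, h1, h2, h3, h' h1, if_true, if_false]
          exact Pop_mono ih x
    · simpa [kk, h1] using kk_nonneg D' U' (n+1) x

lemma kk_le_sh (D U : Set (Zd d)) (f : Zd d → ℝ) (hf0 : ∀ x, 0 ≤ f x) (hf : ∀ x, Pop f x ≤ f x)
    (hD : ∀ x ∈ D, 1 ≤ f x) (n : ℕ) (x : Zd d) : kk D U n x ≤ f x := by
  induction n generalizing x with
  | zero =>
    unfold kk; split_ifs with h1 h2
    · exact hD x h2
    · exact hf0 x
    · exact hf0 x
  | succ n ih =>
    unfold kk; split_ifs with h1 h2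
    · exact hD x h2
    · exact (Pop_mono ih x).trans (hf x)
    · exact hf0 x

lemma kk_univ_le (hd : 3 ≤ d) (D U : Set (Zd d)) (ε : ℝ) (hε : 0 ≤ ε)
    (h : ∀ n, ∀ x ∉ U, kk D univ n x ≤ ε) (n : ℕ) (x : Zd d) :
    kk D univ n x ≤ kk D U n x + ε := by
  induction n generalizing x with
  | zero =>
    by_cases h1 : x ∈ U
    · by_cases h2 : x ∈ D <;> simp [kk, h1, h2, hε]
    · linarith [h 0 x h1, kk_nonneg D U 0 x]
  | succ n ih =>
    by_cases h1 : x ∈ U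
    · by_cases h2 : x ∈ D
      · simp [kk, h1, h2, hε]
      · simp only [kk, h1, h2, mem_univ, if_true, if_false]
        refine (Pop_mono ih x).trans ?_
        rw [Pop_add, Pop_const hd]
    · linarith [h (n+1) x h1, kk_nonneg D U (n+1) x]

lemma kk_translate (D : Set (Zd d)) (v : Zd d) (n : ℕ) (x : Zd d) :
    kk {y | y + v ∈ D} univ n x = kk D univ n (x + v) := by
  induction n generalizing x with
  | zero => simp [kk]
  | succ n ih =>
    simp only [kk, mem_univ, if_true, mem_ofPred_eq]
    congr 1
    unfold Pop
    congr 1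
    refine Finset.sum_congr rfl fun b _ => ?_
    rw [ih]; congr 1; abel

/-! ### Probability -/

section prob

variable {Ω : Type*} [MeasurableSpace Ω] (W : SRW d Ω)

lemma exp_univ : expMeasure univ = 1 := by
  unfold expMeasure
  rw [withDensity_apply _ MeasurableSet.univ]
  rw [setLIntegral_univ]
  have h : (fun t : ℝ => ENNReal.ofReal (if 0 < t then Real.exp (-t) else 0)) =
      (Ioi (0:ℝ)).indicator fun t => ENNReal.ofReal (Real.exp (-t)) := by
    funext t
    by_cases ht : 0 < t <;> simp [indicator, ht]
  rw [h, lintegral_indicator measurableSet_Ioi, ← ofReal_integral_eq_lintegral_ofReal]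
  · rw [integral_exp_neg_Ioi]; simp
  · exact integrableOn_exp_neg_Ioi 0
  · exact Eventually.of_forall fun t => (Real.exp_pos _).le

lemma exp_Iic_zero : expMeasure (Iic 0) = 0 := by
  unfold expMeasure
  rw [withDensity_apply _ measurableSet_Iic]
  rw [setLIntegral_congr_fun (g := fun _ => 0) measurableSet_Iic]
  · simp
  · intro t ht
    have : ¬ (0 < t) := not_lt.2 ht
    simp [this]

lemma exp_Iic_one : expMeasure (Iic 1) < 1 := by
  have h1 : expMeasure (Iic 1) + expMeasure (Ioi 1) = 1 := by
    have := measure_add_measure_compl (μ := expMeasure) (measurableSet_Iic (a := (1:ℝ)))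
    rwa [compl_Iic, exp_univ] at this
  have h2 : expMeasure (Ioi 1) ≠ 0 := by
    unfold expMeasure
    rw [withDensity_apply _ measurableSet_Ioi]
    rw [setLIntegral_congr_fun (g := fun t => ENNReal.ofReal (Real.exp (-t))) measurableSet_Ioi]
    · rw [← ofReal_integral_eq_lintegral_ofReal]
      · rw [integral_exp_neg_Ioi]; simp [Real.exp_pos]
      · exact integrableOn_exp_neg_Ioi 1
      · exact Eventually.of_forall fun t => (Real.exp_pos _).le
    · intro t ht
      have : (0 : ℝ) < t := lt_trans one_pos ht
      simp [this]
  have h3 : expMeasure (Iic 1) ≤ 1 := by rw [← h1]; exact le_self_add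
  refine lt_of_le_of_ne h3 fun h => h2 ?_
  rw [h] at h1
  have : (1 : ℝ≥0∞) + expMeasure (Ioi 1) = 1 + 0 := by rw [h1, add_zero]
  exact (ENNReal.add_right_inj ENNReal.one_ne_top).1 this

lemma law_steps (x : Zd d) (n : ℕ) (s : Fin n → Zd d) :
    W.P x {ω | ∀ i : Fin n, W.Y ((i : ℕ) + 1) ω - W.Y (i : ℕ) ω = s i} = ∏ i, stepP d (s i) := by
  have := W.law x n s (fun _ => univ) (fun _ => MeasurableSet.univ)
  simpa [exp_univ] using this

lemma meas_Yeq (n : ℕ) (A : Set (Zd d)) : MeasurableSet {ω | W.Y n ω ∈ A} :=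
  W.measurable_Y n (Set.to_countable A).measurableSet

lemma meas_steps (n : ℕ) (s : Fin n → Zd d) :
    MeasurableSet {ω | ∀ i : Fin n, W.Y ((i : ℕ) + 1) ω - W.Y (i : ℕ) ω = s i} := by
  have h : ∀ i : Fin n, MeasurableSet {ω | W.Y ((i : ℕ) + 1) ω - W.Y (i : ℕ) ω = s i} := fun i =>
    ((W.measurable_Y _).sub (W.measurable_Y _)) (measurableSet_singleton (s i))
  have : {ω | ∀ i : Fin n, W.Y ((i : ℕ) + 1) ω - W.Y (i : ℕ) ω = s i}
    = ⋂ i : Fin n, {ω | W.Y ((i : ℕ) + 1) ω - W.Y (i : ℕ) ω = s i} := by ext; simp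
  rw [this]
  exact MeasurableSet.iInter h

lemma law_zeta (x : Zd d) (n : ℕ) (I : Fin n → Set ℝ) (hI : ∀ i, MeasurableSet (I i)) :
    W.P x {ω | ∀ i : Fin n, W.ζ (i : ℕ) ω ∈ I i} = ∏ i, expMeasure (I i) := by
  have := W.isProb x
  set Z : Set Ω := {ω | ∀ i : Fin n, W.ζ (i : ℕ) ω ∈ I i} with hZ
  have hZm : MeasurableSet Z := by
    have : Z = ⋂ i : Fin n, (W.ζ (i : ℕ)) ⁻¹' (I i) := by ext; simp [hZ]
    rw [this]; exact MeasurableSet.iInter fun i => W.measurable_ζ _ (hI i)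
  let E : (Fin n → Zd d) → Set Ω := fun s =>
    {ω | ∀ i : Fin n, W.Y ((i : ℕ) + 1) ω - W.Y (i : ℕ) ω = s i}
  have hU : (⋃ s, E s) = univ := by
    ext ω; simp only [mem_iUnion, mem_univ, iff_true]
    exact ⟨fun i => W.Y ((i : ℕ) + 1) ω - W.Y (i : ℕ) ω, fun i => rfl⟩
  have hdis : Pairwise (Function.onFun Disjoint E) := by
    intro s s' hne
    refine Set.disjoint_left.2 fun ω h h' => hne ?_
    funext i
    exact (h i).symm.trans (h' i)
  have h1 : W.P x Z = ∑' s, W.P x (E s ∩ Z) := by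
    rw [← measure_iUnion (fun s s' hne => (hdis hne).mono inter_subset_left inter_subset_left)
      (fun s => (meas_steps W n s).inter hZm), ← iUnion_inter, hU, univ_inter]
  have h2 : ∑' s, W.P x (E s) = 1 := by
    rw [← measure_iUnion hdis (fun s => meas_steps W n s), hU, measure_univ]
  have h3 : ∀ s, W.P x (E s ∩ Z) = W.P x (E s) * ∏ i, expMeasure (I i) := by
    intro s
    have a := W.law x n s I hI
    have b := law_steps W x n s
    change W.P x (E s) = _ at b
    rw [b, ← a]; rfl
  rw [h1]
  simp_rw [h3]
  rw [ENNReal.tsum_mul_right, h2, one_mul]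

lemma ae_zeta_pos (x : Zd d) : ∀ᵐ ω ∂(W.P x), ∀ n, 0 < W.ζ n ω := by
  rw [ae_all_iff]
  intro n
  rw [ae_iff]
  have h := law_zeta W x (n+1) (fun i => if i = Fin.last n then Iic 0 else univ)
    (fun i => by split_ifs; exacts [measurableSet_Iic, MeasurableSet.univ])
  rw [Finset.prod_eq_zero (Finset.mem_univ (Fin.last n)) (by simp [exp_Iic_zero])] at h
  refine measure_mono_null ?_ h
  intro ω hω i
  by_cases hi : i = Fin.last n
  · subst hi; simpa using hω
  · simp [hi]

lemma ae_zeta_large (x : Zd d) : ∀ᵐ ω ∂(W.P x), ∀ n, ∃ m, n ≤ m ∧ 1 < W.ζ m ω := by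
  rw [ae_all_iff]
  intro n
  rw [ae_iff]
  set q := expMeasure (Iic 1) with hq
  have hb : ∀ k : ℕ, W.P x {ω | ¬ ∃ m, n ≤ m ∧ 1 < W.ζ m ω} ≤ q ^ k := by
    intro k
    have h := law_zeta W x (n+k) (fun i => if n ≤ (i : ℕ) then Iic 1 else univ)
      (fun i => by split_ifs; exacts [measurableSet_Iic, MeasurableSet.univ])
    have hp : ∏ i : Fin (n + k), expMeasure (if n ≤ (i : ℕ) then Iic 1 else univ) = q ^ k := by
      rw [Fin.prod_univ_add]
      have h1 : ∀ i : Fin n, expMeasure (if n ≤ ((Fin.castAdd k i : Fin (n+k)) : ℕ)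
          then Iic 1 else univ) = 1 := by
        intro i
        have : ¬ n ≤ (i : ℕ) := not_le.2 i.2
        simp [this, exp_univ]
      have h2 : ∀ i : Fin k, expMeasure (if n ≤ ((Fin.natAdd n i : Fin (n+k)) : ℕ)
          then Iic 1 else univ) = q := by
        intro i
        simp [hq]
      rw [Finset.prod_congr rfl (fun i _ => h1 i), Finset.prod_congr rfl (fun i _ => h2 i)]
      simp
    rw [hp] at h
    rw [← h]
    refine measure_mono ?_
    intro ω hω i
    by_cases hi : n ≤ (i : ℕ)
    · have : ¬ (1 < W.ζ i ω) := fun h => hω ⟨i, hi, h⟩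
      simpa [hi] using this
    · simp [hi]
  have ht : Tendsto (fun k => q ^ k) atTop (𝓝 0) := ENNReal.tendsto_pow_atTop_nhds_zero_of_lt_one exp_Iic_one
  exact le_antisymm (ge_of_tendsto' ht hb) bot_le

/-- good paths -/
def Good (ω : Ω) : Prop := (∀ n, 0 < W.ζ n ω) ∧ ∀ n, ∃ m, n ≤ m ∧ 1 < W.ζ m ω

lemma ae_good (x : Zd d) : ∀ᵐ ω ∂(W.P x), Good W ω := by
  filter_upwards [ae_zeta_pos W x, ae_zeta_large W x] with ω h1 h2 using ⟨h1, h2⟩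

variable {W}

lemma S_strictMono {ω : Ω} (h : Good W ω) : StrictMono fun n => W.S n ω := by
  refine strictMono_nat_of_lt_succ fun n => ?_
  simp only [SRW.S, Finset.sum_range_succ]
  linarith [h.1 n]

lemma S_unbdd {ω : Ω} (h : Good W ω) (k : ℕ) : ∃ n, (k : ℝ) ≤ W.S n ω := by
  induction k with
  | zero => exact ⟨0, by simp [SRW.S]⟩
  | succ k ih =>
    obtain ⟨n, hn⟩ := ih
    obtain ⟨m, hm, h1⟩ := h.2 n
    refine ⟨m + 1, ?_⟩
    have := (S_strictMono h).monotone hm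
    simp only [SRW.S, Finset.sum_range_succ] at *
    push_cast
    linarith

lemma jump_spec {ω : Ω} (h : Good W ω) (t : ℝ) (n : ℕ) (h1 : W.S n ω ≤ t)
    (h2 : t < W.S (n+1) ω) : W.jumpIdx t ω = n := by
  have : {k : ℕ | W.S k ω ≤ t} = Iic n := by
    ext k
    simp only [mem_ofPred_eq, mem_Iic]
    constructor
    · intro hk
      have := (S_strictMono h).lt_iff_lt.1 (lt_of_le_of_lt hk h2)
      omega
    · intro hk
      exact ((S_strictMono h).monotone hk).trans h1
  unfold SRW.jumpIdx
  rw [this]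
  exact isLUB_Iic.csSup_eq ⟨n, le_refl n⟩

lemma S_nonneg {ω : Ω} (h : Good W ω) (n : ℕ) : 0 ≤ W.S n ω := by
  have := (S_strictMono h).monotone (Nat.zero_le n)
  simpa [SRW.S] using this

/-- jump times as nonnegative reals -/
noncomputable def SN {ω : Ω} (h : Good W ω) (n : ℕ) : ℝ≥0 := ⟨W.S n ω, S_nonneg h n⟩

lemma X_S {ω : Ω} (h : Good W ω) (n : ℕ) : W.X (W.S n ω) ω = W.Y n ω := by
  unfold SRW.X
  rw [jump_spec h _ n le_rfl (S_strictMono h n.lt_succ_self)]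

lemma X_exists {ω : Ω} (h : Good W ω) (t : ℝ) (ht : 0 ≤ t) :
    ∃ n, W.S n ω ≤ t ∧ t < W.S (n+1) ω ∧ W.X t ω = W.Y n ω := by
  have hex : ∃ n, t < W.S n ω := by
    obtain ⟨k, hk⟩ := exists_nat_gt t
    obtain ⟨n, hn⟩ := S_unbdd h k
    exact ⟨n, hk.trans_le hn⟩
  have h0 : Nat.find hex ≠ 0 := by
    intro h0
    have := Nat.find_spec hex
    rw [h0] at this
    simp [SRW.S] at this
    linarith
  obtain ⟨n, hn⟩ := Nat.exists_eq_succ_of_ne_zero h0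
  have h1 : W.S n ω ≤ t := not_lt.1 (Nat.find_min hex (m := n) (by omega))
  have h2 : t < W.S (n+1) ω := by
    have := Nat.find_spec hex
    rwa [hn] at this
  refine ⟨n, h1, h2, ?_⟩
  unfold SRW.X
  rw [jump_spec h t n h1 h2]

lemma hit_lt_exit_iff {ω : Ω} (h : Good W ω) (D U : Set (Zd d)) :
    W.hit D ω < W.exit U ω ↔ ∃ k, W.Y k ω ∈ D ∧ ∀ j ≤ k, W.Y j ω ∈ U := by
  constructor
  · intro hlt
    unfold SRW.hit SRW.hitFrom at hlt
    rw [sInf_lt_iff] at hlt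
    obtain ⟨u, ⟨s, rfl, -, hs⟩, hlt⟩ := hlt
    obtain ⟨k, hk1, -, hk2⟩ := X_exists h s s.2
    refine ⟨k, hk2 ▸ hs, fun j hj => ?_⟩
    by_contra hU
    have : W.exit U ω ≤ ((SN h j : ℝ≥0) : ℝ≥0∞) := by
      refine sInf_le ⟨_, rfl, zero_le, ?_⟩
      show W.X (W.S j ω) ω ∈ Uᶜ
      rw [X_S h]; exact hU
    have h2 := lt_of_lt_of_le hlt this
    rw [ENNReal.coe_lt_coe, ← NNReal.coe_lt_coe] at h2
    have h3 : W.S j ω ≤ W.S k ω := (S_strictMono h).monotone hj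
    change (s : ℝ) < W.S j ω at h2
    linarith
  · rintro ⟨k, hk, hj⟩
    have h1 : W.hit D ω ≤ ((SN h k : ℝ≥0) : ℝ≥0∞) := by
      refine sInf_le ⟨_, rfl, zero_le, ?_⟩
      show W.X (W.S k ω) ω ∈ D
      rw [X_S h]; exact hk
    have h2 : ((SN h (k+1) : ℝ≥0) : ℝ≥0∞) ≤ W.exit U ω := by
      refine le_sInf ?_
      rintro u ⟨s, rfl, -, hs⟩
      obtain ⟨m, hm1, -, hm2⟩ := X_exists h s s.2
      rw [hm2] at hs
      have : k + 1 ≤ m := by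
        by_contra hn
        exact hs (hj m (by omega))
      rw [ENNReal.coe_le_coe, ← NNReal.coe_le_coe]
      exact ((S_strictMono h).monotone this).trans hm1
    refine lt_of_le_of_lt h1 (lt_of_lt_of_le ?_ h2)
    rw [ENNReal.coe_lt_coe, ← NNReal.coe_lt_coe]
    exact S_strictMono h k.lt_succ_self

lemma hitTilde_top_iff {ω : Ω} (h : Good W ω) (A : Set (Zd d)) :
    W.hitTilde A ω = ⊤ ↔ ¬ ∃ k, W.Y (1 + k) ω ∈ A := by
  have hS1 : W.S 1 ω = W.ζ 0 ω := by simp [SRW.S]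
  unfold SRW.hitTilde SRW.hitFrom
  rw [sInf_eq_top]
  constructor
  · rintro hall ⟨k, hk⟩
    have := hall ((SN h (1 + k) : ℝ≥0) : ℝ≥0∞) ⟨_, rfl, ?_, ?_⟩
    · exact ENNReal.coe_ne_top this
    · rw [ENNReal.ofReal, ENNReal.coe_le_coe, ← NNReal.coe_le_coe, Real.coe_toNNReal _ (h.1 0).le]
      rw [← hS1]
      exact (S_strictMono h).monotone (by omega)
    · show W.X (W.S (1 + k) ω) ω ∈ A
      rw [X_S h]; exact hk
  · rintro hn u ⟨s, rfl, h1, hs⟩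
    exfalso
    obtain ⟨m, hm1, hm3, hm2⟩ := X_exists h s s.2
    rw [hm2] at hs
    rw [ENNReal.ofReal, ENNReal.coe_le_coe, ← NNReal.coe_le_coe, Real.coe_toNNReal _ (h.1 0).le,
      ← hS1] at h1
    have := (S_strictMono h).lt_iff_lt.1 (lt_of_le_of_lt h1 hm3)
    exact hn ⟨m - 1, by rwa [show 1 + (m - 1) = m by omega]⟩

end prob

section markov

variable {Ω : Type*} [MeasurableSpace Ω] (W : SRW d Ω)

/-- cylinder event -/
def Cyl (m : ℕ) (y : ℕ → Zd d) : Set Ω := {ω | ∀ i ≤ m, W.Y i ω = y i}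

/-- hitting event -/
def Hit (D U : Set (Zd d)) (m n : ℕ) : Set Ω :=
  {ω | ∃ k ≤ n, W.Y (m + k) ω ∈ D ∧ ∀ j ≤ k, W.Y (m + j) ω ∈ U}

/-- hitting event, unlimited time -/
def HitInf (D U : Set (Zd d)) (m : ℕ) : Set Ω :=
  {ω | ∃ k, W.Y (m + k) ω ∈ D ∧ ∀ j ≤ k, W.Y (m + j) ω ∈ U}

lemma meas_Cyl (m : ℕ) (y : ℕ → Zd d) : MeasurableSet (Cyl W m y) := by
  have : Cyl W m y = ⋂ i, ⋂ (_ : i ≤ m), {ω | W.Y i ω ∈ ({y i} : Set (Zd d))} := by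
    ext; simp [Cyl]
  rw [this]
  exact MeasurableSet.iInter fun i => MeasurableSet.iInter fun _ => meas_Yeq W i _

lemma meas_Hit (D U : Set (Zd d)) (m n : ℕ) : MeasurableSet (Hit W D U m n) := by
  have : Hit W D U m n = ⋃ k, ⋃ (_ : k ≤ n), ({ω | W.Y (m + k) ω ∈ D} ∩
      ⋂ j, ⋂ (_ : j ≤ k), {ω | W.Y (m + j) ω ∈ U}) := by
    ext; simp only [Hit, mem_iUnion, exists_prop, mem_inter_iff, mem_iInter, mem_ofPred_eq]
  rw [this]
  exact MeasurableSet.iUnion fun k => MeasurableSet.iUnion fun _ => (meas_Yeq W _ _).inter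
    (MeasurableSet.iInter fun i => MeasurableSet.iInter fun _ => meas_Yeq W _ _)

lemma HitInf_eq (D U : Set (Zd d)) (m : ℕ) : HitInf W D U m = ⋃ n, Hit W D U m n := by
  ext ω
  simp only [HitInf, Hit, mem_iUnion, mem_ofPred_eq]
  constructor
  · rintro ⟨k, hk⟩; exact ⟨k, k, le_rfl, hk⟩
  · rintro ⟨_, k, _, hk⟩; exact ⟨k, hk⟩

lemma Hit_mono (D U : Set (Zd d)) (m : ℕ) : Monotone (Hit W D U m) := by
  rintro n n' h ω ⟨k, hk, hk'⟩
  exact ⟨k, hk.trans h, hk'⟩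

lemma ae_Y0 (x : Zd d) : ∀ᵐ ω ∂(W.P x), W.Y 0 ω = x := by
  have := W.isProb x
  have h := W.Y_zero x
  have hm : MeasurableSet {ω | W.Y 0 ω = x} := meas_Yeq W 0 {x}
  exact (prob_compl_eq_zero_iff hm).2 h

lemma P_Cyl (x : Zd d) (m : ℕ) (y : ℕ → Zd d) : W.P x (Cyl W m y) =
    if y 0 = x then ∏ i : Fin m, stepP d (y (i + 1) - y i) else 0 := by
  split_ifs with h
  · rw [← law_steps W x m (fun i => y (i + 1) - y i)]
    apply measure_congr
    filter_upwards [ae_Y0 W x] with ω hω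
    apply propext
    change (∀ i ≤ m, W.Y i ω = y i) ↔
      ∀ i : Fin m, W.Y ((i : ℕ) + 1) ω - W.Y (i : ℕ) ω = y (i + 1) - y i
    constructor
    · intro hy i
      rw [hy _ (by omega), hy _ (by omega)]
    · intro hs i hi
      induction i with
      | zero => rw [hω, h]
      | succ i ih =>
        have h1 := hs ⟨i, by omega⟩
        simp only [ih (by omega)] at h1
        simpa using h1
  · refine measure_mono_null ?_ (show W.P x {ω | ¬ W.Y 0 ω = x} = 0 from ae_Y0 W x)
    intro ω hω h0
    exact h ((hω 0 (Nat.zero_le _)).symm.trans h0)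

lemma stepP_stp (b : Fin d × Bool) : stepP d (stp b) = ((2 * d : ℕ) : ℝ≥0∞)⁻¹ := by
  unfold stepP
  rw [if_pos]
  rcases b with ⟨i, b⟩
  rw [Finset.sum_eq_single i]
  · cases b <;> simp [stp]
  · intro j _ hj; cases b <;> simp [stp, Pi.single_eq_of_ne hj]
  · simp

lemma stp_inj : Function.Injective (stp : Fin d × Bool → Zd d) := by
  rintro ⟨i, b⟩ ⟨j, b'⟩ h
  have hij : i = j := by
    by_contra hne
    have := congrFun h i
    cases b <;> cases b' <;> simp [stp, Pi.single_eq_of_ne hne] at this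
  subst hij
  have := congrFun h i
  cases b <;> cases b' <;> simp [stp] at this ⊢

/-- extended path -/
noncomputable def ext (m : ℕ) (y : ℕ → Zd d) (b : Fin d × Bool) : ℕ → Zd d :=
  Function.update y (m + 1) (y m + stp b)

lemma P_Cyl_ext (x : Zd d) (m : ℕ) (y : ℕ → Zd d) (b : Fin d × Bool) :
    (W.P x).real (Cyl W (m + 1) (ext m y b)) = (W.P x).real (Cyl W m y) / (2 * d) := by
  have h : W.P x (Cyl W (m + 1) (ext m y b)) = W.P x (Cyl W m y) * ((2 * d : ℕ) : ℝ≥0∞)⁻¹ := by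
    rw [P_Cyl, P_Cyl]
    have h0 : ext m y b 0 = y 0 := by simp [ext]
    have h1 : ∀ i : ℕ, i ≤ m → ext m y b i = y i := fun i hi => by
      simp [ext, Function.update_of_ne (show i ≠ m + 1 by omega)]
    rw [h0]
    split_ifs
    · rw [Fin.prod_univ_castSucc]
      congr 1
      · refine Finset.prod_congr rfl fun i _ => ?_
        have := i.2
        simp only [Fin.val_castSucc]
        rw [h1 _ (by omega), h1 _ (by omega)]
      · simp only [Fin.val_last]
        rw [h1 m le_rfl, ← stepP_stp b]
        simp [ext]
    · simp
  rw [Measure.real, h, ENNReal.toReal_mul, ENNReal.toReal_inv]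
  simp [Measure.real, div_eq_mul_inv]

lemma Cyl_ext_sub (m : ℕ) (y : ℕ → Zd d) (b : Fin d × Bool) :
    Cyl W (m + 1) (ext m y b) ⊆ Cyl W m y := by
  intro ω h i hi
  rw [h i (by omega)]
  simp [ext, Function.update_of_ne (show i ≠ m + 1 by omega)]

lemma Cyl_ext_disj (m : ℕ) (y : ℕ → Zd d) :
    Pairwise (Function.onFun Disjoint fun b : Fin d × Bool => Cyl W (m + 1) (ext m y b)) := by
  intro b b' hne
  refine Set.disjoint_left.2 fun ω h h' => hne ?_
  have := (h (m+1) le_rfl).symm.trans (h' (m+1) le_rfl)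
  simp [ext] at this
  exact stp_inj this

lemma Cyl_split (hd : 3 ≤ d) (x : Zd d) (m : ℕ) (y : ℕ → Zd d) (E : Set Ω) (hE : MeasurableSet E) :
    (W.P x).real (Cyl W m y ∩ E) =
      ∑ b : Fin d × Bool, (W.P x).real (Cyl W (m + 1) (ext m y b) ∩ E) := by
  have := W.isProb x
  have hd0 : (d : ℝ) ≠ 0 := by positivity
  have hsub : (⋃ b : Fin d × Bool, Cyl W (m + 1) (ext m y b)) ⊆ Cyl W m y :=
    iUnion_subset fun b => Cyl_ext_sub W m y b
  have hm : ∀ b : Fin d × Bool, MeasurableSet (Cyl W (m + 1) (ext m y b)) := fun b => meas_Cyl W _ _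
  have hreal : (W.P x).real (⋃ b : Fin d × Bool, Cyl W (m + 1) (ext m y b))
      = (W.P x).real (Cyl W m y) := by
    rw [measureReal_iUnion_fintype (Cyl_ext_disj W m y) hm]
    simp_rw [P_Cyl_ext]
    simp
    field_simp
  have hae : (⋃ b : Fin d × Bool, Cyl W (m + 1) (ext m y b)) =ᵐ[W.P x] Cyl W m y := by
    refine ae_eq_of_subset_of_measure_ge hsub ?_ (MeasurableSet.iUnion hm).nullMeasurableSet
      (measure_ne_top _ _)
    exact ((measureReal_eq_measureReal_iff).1 hreal).ge
  rw [← measureReal_congr (hae.inter (ae_eq_refl E)), iUnion_inter,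
    measureReal_iUnion_fintype _ (fun b => (hm b).inter hE)]
  intro b b' hne
  exact (Cyl_ext_disj W m y hne).mono inter_subset_left inter_subset_left

lemma Hit_succ (D U : Set (Zd d)) (m n : ℕ) (ω : Ω) : ω ∈ Hit W D U m (n + 1) ↔
    W.Y m ω ∈ U ∧ (W.Y m ω ∈ D ∨ ω ∈ Hit W D U (m + 1) n) := by
  constructor
  · rintro ⟨k, hk, h1, h2⟩
    refine ⟨h2 0 (Nat.zero_le _), ?_⟩
    rcases k with _ | k
    · left; exact h1
    · right
      refine ⟨k, by omega, ?_, fun j hj => ?_⟩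
      · rwa [show m + 1 + k = m + (k + 1) by ring]
      · have := h2 (j + 1) (by omega)
        rwa [show m + 1 + j = m + (j + 1) by ring]
  · rintro ⟨hU, hD | ⟨k, hk, h1, h2⟩⟩
    · exact ⟨0, by omega, hD, fun j hj => by rwa [Nat.le_zero.1 hj]⟩
    · refine ⟨k + 1, by omega, ?_, fun j hj => ?_⟩
      · rwa [show m + (k + 1) = m + 1 + k by ring]
      · rcases j with _ | j
        · exact hU
        · have := h2 j (by omega)
          rwa [show m + (j + 1) = m + 1 + j by ring]

lemma P_Cyl_Hit (hd : 3 ≤ d) (x : Zd d) (D U : Set (Zd d)) (n m : ℕ) (y : ℕ → Zd d) :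
    (W.P x).real (Cyl W m y ∩ Hit W D U m n) = (W.P x).real (Cyl W m y) * kk D U n (y m) := by
  induction n generalizing m y with
  | zero =>
    have hiff : ∀ ω ∈ Cyl W m y, (ω ∈ Hit W D U m 0 ↔ y m ∈ D ∧ y m ∈ U) := by
      intro ω hω
      have := hω m le_rfl
      simp [Hit, this]
    by_cases h1 : y m ∈ U
    · by_cases h2 : y m ∈ D
      · have : Cyl W m y ∩ Hit W D U m 0 = Cyl W m y :=
          inter_eq_left.2 fun ω hω => (hiff ω hω).2 ⟨h2, h1⟩
        rw [this]; simp [kk, h1, h2]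
      · have : Cyl W m y ∩ Hit W D U m 0 = ∅ := by
          ext ω; simp only [mem_inter_iff, mem_empty_iff_false, iff_false]
          rintro ⟨a, b⟩; exact h2 ((hiff ω a).1 b).1
        rw [this]; simp [kk, h2]
    · have : Cyl W m y ∩ Hit W D U m 0 = ∅ := by
        ext ω; simp only [mem_inter_iff, mem_empty_iff_false, iff_false]
        rintro ⟨a, b⟩; exact h1 ((hiff ω a).1 b).2
      rw [this]; simp [kk, h1]
  | succ n ih =>
    have hiff : ∀ ω ∈ Cyl W m y, (ω ∈ Hit W D U m (n+1) ↔
        y m ∈ U ∧ (y m ∈ D ∨ ω ∈ Hit W D U (m + 1) n)) := by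
      intro ω hω
      rw [Hit_succ, hω m le_rfl]
    by_cases h1 : y m ∈ U
    · by_cases h2 : y m ∈ D
      · have : Cyl W m y ∩ Hit W D U m (n+1) = Cyl W m y :=
          inter_eq_left.2 fun ω hω => (hiff ω hω).2 ⟨h1, Or.inl h2⟩
        rw [this]; simp [kk, h1, h2]
      · have : Cyl W m y ∩ Hit W D U m (n+1) = Cyl W m y ∩ Hit W D U (m+1) n := by
          ext ω
          simp only [mem_inter_iff, and_congr_right_iff]
          intro hω
          rw [hiff ω hω]; simp [h1, h2]
        rw [this, Cyl_split W hd x m y _ (meas_Hit W D U _ _)]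
        simp_rw [ih, P_Cyl_ext]
        simp only [kk, h1, h2, if_true, if_false, Pop]
        rw [← Finset.mul_sum]
        simp only [ext, Function.update_self]
        ring
    · have : Cyl W m y ∩ Hit W D U m (n+1) = ∅ := by
        ext ω; simp only [mem_inter_iff, mem_empty_iff_false, iff_false]
        rintro ⟨a, b⟩; exact h1 ((hiff ω a).1 b).1
      rw [this]; simp [kk, h1]

lemma Cyl_zero_ae (x : Zd d) : Cyl W 0 (fun _ => x) =ᵐ[W.P x] univ := by
  filter_upwards [ae_Y0 W x] with ω hω
  apply propext
  change (∀ i ≤ 0, W.Y i ω = x) ↔ True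
  simp [hω]

lemma P_Hit (hd : 3 ≤ d) (x : Zd d) (D U : Set (Zd d)) (n : ℕ) :
    (W.P x).real (Hit W D U 0 n) = kk D U n x := by
  have := W.isProb x
  have h := P_Cyl_Hit W hd x D U n 0 (fun _ => x)
  rw [measureReal_congr ((Cyl_zero_ae W x).inter (ae_eq_refl (Hit W D U 0 n))),
    measureReal_congr (Cyl_zero_ae W x)] at h
  simpa using h

lemma P_Hit_one (hd : 3 ≤ d) (x : Zd d) (D U : Set (Zd d)) (n : ℕ) :
    (W.P x).real (Hit W D U 1 n) = Pop (kk D U n) x := by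
  have := W.isProb x
  have h := Cyl_split W hd x 0 (fun _ => x) (Hit W D U 1 n) (meas_Hit W _ _ _ _)
  simp only [zero_add] at h
  simp_rw [P_Cyl_Hit W hd] at h
  have h2 := P_Cyl_ext W x 0 (fun _ => x)
  simp only [zero_add] at h2
  simp_rw [h2] at h
  rw [measureReal_congr ((Cyl_zero_ae W x).inter (ae_eq_refl (Hit W D U 1 n))),
    measureReal_congr (Cyl_zero_ae W x)] at h
  rw [← Finset.mul_sum] at h
  simp only [univ_inter, probReal_univ] at h
  rw [h]
  simp [Pop, ext]
  ring

/-- hitting probability -/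
noncomputable def kl (D U : Set (Zd d)) (x : Zd d) : ℝ := (W.P x).real (HitInf W D U 0)

lemma tendsto_HitInf (x : Zd d) (D U : Set (Zd d)) (m : ℕ) :
    Tendsto (fun n => (W.P x).real (Hit W D U m n)) atTop (𝓝 ((W.P x).real (HitInf W D U m))) := by
  have := W.isProb x
  rw [HitInf_eq]
  exact (ENNReal.tendsto_toReal (measure_ne_top _ _)).comp
    (tendsto_measure_iUnion_atTop (Hit_mono W D U m))

lemma kl_tendsto (hd : 3 ≤ d) (D U : Set (Zd d)) (x : Zd d) :
    Tendsto (fun n => kk D U n x) atTop (𝓝 (kl W D U x)) := by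
  have := tendsto_HitInf W x D U 0
  simp_rw [P_Hit W hd] at this
  exact this

lemma P_HitInf_one (hd : 3 ≤ d) (D U : Set (Zd d)) (x : Zd d) :
    (W.P x).real (HitInf W D U 1) = Pop (kl W D U) x := by
  have := tendsto_HitInf W x D U 1
  simp_rw [P_Hit_one W hd] at this
  exact tendsto_nhds_unique this (Pop_tendsto (kl_tendsto W hd D U) x)

lemma P_hit_exit (D U : Set (Zd d)) (x : Zd d) :
    (W.P x {ω | W.hit D ω < W.exit U ω}).toReal = kl W D U x := by
  change (W.P x).real _ = _
  unfold kl
  apply measureReal_congr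
  filter_upwards [ae_good W x] with ω hω
  apply propext
  change W.hit D ω < W.exit U ω ↔ ω ∈ HitInf W D U 0
  rw [hit_lt_exit_iff hω]
  simp [HitInf]

lemma eqm_eq (hd : 3 ≤ d) (A : Set (Zd d)) (x : Zd d) :
    W.eqm A x = if x ∈ A then 1 - Pop (kl W A univ) x else 0 := by
  have := W.isProb x
  unfold SRW.eqm
  congr 1
  rw [← P_HitInf_one W hd, ← probReal_compl_eq_one_sub]
  · change (W.P x).real _ = _
    apply measureReal_congr
    filter_upwards [ae_good W x] with ω hω
    apply propext
    change W.hitTilde A ω = ⊤ ↔ ω ∉ HitInf W A univ 1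
    rw [hitTilde_top_iff hω]
    simp [HitInf]
  · rw [HitInf_eq]
    exact MeasurableSet.iUnion fun n => meas_Hit W _ _ _ _

end markov

section final

variable {Ω : Type*} [MeasurableSpace Ω] (W : SRW d Ω)

lemma kl_nonneg (D U : Set (Zd d)) (x : Zd d) : 0 ≤ kl W D U x := measureReal_nonneg

lemma kl_le_one (D U : Set (Zd d)) (x : Zd d) : kl W D U x ≤ 1 := by
  have := W.isProb x
  exact measureReal_le_one

lemma kl_mem (hd : 3 ≤ d) (A : Set (Zd d)) (x : Zd d) (hx : x ∈ A) : kl W A univ x = 1 := by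
  refine tendsto_nhds_unique (kl_tendsto W hd A univ x) ?_
  refine tendsto_const_nhds.congr fun n => ?_
  cases n <;> simp [kk, hx]

lemma kl_harm (hd : 3 ≤ d) (A : Set (Zd d)) (x : Zd d) (hx : x ∉ A) :
    kl W A univ x = Pop (kl W A univ) x := by
  have h1 := (tendsto_add_atTop_iff_nat 1).2 (kl_tendsto W hd A univ x)
  have h2 := Pop_tendsto (kl_tendsto W hd A univ) x
  refine tendsto_nhds_unique h1 (h2.congr fun n => ?_)
  simp [kk, hx]

lemma eqm_lap (hd : 3 ≤ d) (A : Set (Zd d)) (x : Zd d) :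
    W.eqm A x = kl W A univ x - Pop (kl W A univ) x := by
  rw [eqm_eq W hd]
  split_ifs with h
  · rw [kl_mem W hd A x h]
  · rw [← kl_harm W hd A x h, sub_self]

lemma kl_mono (hd : 3 ≤ d) {D D' U U' : Set (Zd d)} (h : D ⊆ D') (h' : U ⊆ U') (x : Zd d) :
    kl W D U x ≤ kl W D' U' x :=
  le_of_tendsto_of_tendsto' (kl_tendsto W hd D U x) (kl_tendsto W hd D' U' x)
    fun n => kk_mono hd D D' U U' h h' n x

lemma kk_sh {a : ℝ} (ha : 1 ≤ a) (hsup : ∀ x : Zd d, Pop (sh d a) x ≤ sh d a x)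
    (D U : Set (Zd d)) (m : ℝ) (hm : 0 < m) (hD : ∀ x ∈ D, m ≤ sh d a x) (n : ℕ) (x : Zd d) :
    kk D U n x ≤ m⁻¹ * sh d a x := by
  have hm' : 0 < m⁻¹ := inv_pos.2 hm
  refine kk_le_sh D U (fun x => m⁻¹ * sh d a x) (fun x => ?_) (fun x => ?_) (fun x hx => ?_) n x
  · exact mul_nonneg hm'.le (sh_nonneg a ha x)
  · rw [Pop_smul]; exact mul_le_mul_of_nonneg_left (hsup x) hm'.le
  · rw [inv_mul_eq_div, le_div_iff₀ hm, one_mul]; exact hD x hx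

lemma kl_bound (hd : 3 ≤ d) {a : ℝ} (ha : 1 ≤ a) (hsup : ∀ x : Zd d, Pop (sh d a) x ≤ sh d a x)
    {A : Set (Zd d)} (hA : A.Finite) : ∃ c : ℝ, 0 < c ∧ ∀ x, kl W A univ x ≤ c * sh d a x := by
  have : ∃ m > 0, ∀ x ∈ A, m ≤ sh d a x := by
    rcases A.eq_empty_or_nonempty with h | h
    · exact ⟨1, one_pos, by simp [h]⟩
    · obtain ⟨y, _, hy⟩ := hA.exists_minimalFor (sh d a) A h
      refine ⟨sh d a y, sh_pos a ha y, fun x hx => ?_⟩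
      rcases le_total (sh d a x) (sh d a y) with h1 | h1
      · exact hy hx h1
      · exact h1
  obtain ⟨m, hm, hD⟩ := this
  exact ⟨m⁻¹, inv_pos.2 hm, fun x => le_of_tendsto' (kl_tendsto W hd A univ x)
    fun n => kk_sh ha hsup A univ m hm hD n x⟩

lemma eqm_nonneg (A : Set (Zd d)) (x : Zd d) : 0 ≤ W.eqm A x := by
  unfold SRW.eqm; split_ifs <;> simp

lemma eqm_supp {A : Set (Zd d)} (hA : A.Finite) : (Function.support (W.eqm A)).Finite := by
  refine hA.subset fun x hx => ?_
  by_contra h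
  exact hx (by simp [SRW.eqm, h])

lemma cap_tsum {A : Set (Zd d)} (hA : A.Finite) : W.cap A = ∑' x, W.eqm A x :=
  (tsum_eq_finsum (eqm_supp W hA)).symm

lemma eqm_summable {A : Set (Zd d)} (hA : A.Finite) : Summable (W.eqm A) :=
  summable_of_hasFiniteSupport (eqm_supp W hA)

lemma sweep (hd : 3 ≤ d) {A B : Set (Zd d)} (hA : A.Finite) (hB : B.Finite) (h : A ⊆ B) :
    ∑' x, W.eqm B x * kl W A univ x = W.cap A := by
  obtain ⟨a, ha, hsup⟩ := exists_sh hd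
  obtain ⟨c1, -, h1⟩ := kl_bound W hd ha hsup hA
  obtain ⟨c2, -, h2⟩ := kl_bound W hd ha hsup hB
  rw [recip (eqm_supp W hB) (eqm_supp W hA) (eqm_lap W hd B) (eqm_lap W hd A)
    (iter_tendsto hd ha hsup _ c2 (kl_nonneg W _ _) h2)
    (iter_tendsto hd ha hsup _ c1 (kl_nonneg W _ _) h1), cap_tsum W hA]
  refine tsum_congr fun x => ?_
  by_cases hx : x ∈ A
  · rw [kl_mem W hd B x (h hx), mul_one]
  · simp [SRW.eqm, hx]

lemma cap_mono (hd : 3 ≤ d) {A B : Set (Zd d)} (hA : A.Finite) (hB : B.Finite) (h : A ⊆ B) :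
    W.cap A ≤ W.cap B := by
  rw [← sweep W hd hA hB h, cap_tsum W hB]
  refine Summable.tsum_le_tsum (fun x => ?_) (summ_fin (eqm_supp W hB) _) (eqm_summable W hB)
  exact mul_le_of_le_one_right (eqm_nonneg W B x) (kl_le_one W _ _ x)

lemma cap_pos (hd : 3 ≤ d) {A : Set (Zd d)} (hA : A.Finite) (hne : A.Nonempty) : 0 < W.cap A := by
  rw [cap_tsum W hA]
  by_contra hn
  have h0 : ∀ x, W.eqm A x = 0 := by
    intro x
    have h1 := (eqm_summable W hA).le_tsum x (fun y _ => eqm_nonneg W A y)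
    linarith [eqm_nonneg W A x]
  obtain ⟨a, ha, hsup⟩ := exists_sh hd
  obtain ⟨c, hc, h1⟩ := kl_bound W hd ha hsup hA
  obtain ⟨x, hx⟩ := hne
  have := max_principle hd (kl W A univ) (fun x => by
    have := eqm_lap W hd A x
    rw [h0] at this; linarith) (fun ε hε => by
      refine (sh_finite hd a ha (c⁻¹ * ε) (by positivity)).subset fun y hy => ?_
      have h2 : ε ≤ c * sh d a y := le_trans hy (h1 y)
      change c⁻¹ * ε ≤ sh d a y
      rwa [inv_mul_eq_div, div_le_iff₀' hc]) x
  rw [kl_mem W hd A x hx] at this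
  linarith

lemma eqm_translate (hd : 3 ≤ d) (D : Set (Zd d)) (v x : Zd d) :
    W.eqm {y | y + v ∈ D} x = W.eqm D (x + v) := by
  have hk : ∀ x, kl W {y | y + v ∈ D} univ x = kl W D univ (x + v) := fun x =>
    tendsto_nhds_unique (kl_tendsto W hd _ _ x)
      ((kl_tendsto W hd D univ (x + v)).congr fun n => (kk_translate D v n x).symm)
  rw [eqm_lap W hd, eqm_lap W hd, hk]
  congr 1
  unfold Pop
  congr 1
  refine Finset.sum_congr rfl fun b _ => ?_
  rw [hk]; congr 1; abel

lemma intBox_finite (a b : ℤ) : (intBox a b : Set (Zd d)).Finite := by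
  refine (Set.finite_Icc (fun _ => a) (fun _ : Fin d => b)).subset ?_
  intro x hx
  exact ⟨fun i => (hx i).1, fun i => (hx i).2.le⟩

lemma summable_shift (v : Zd d) (f : Zd d → ℝ) (hf : Summable f) :
    Summable fun x => f (x + v) :=
  hf.comp_injective (add_left_injective v)

lemma tsum_shift (v : Zd d) (f : Zd d → ℝ) : ∑' x, f (x + v) = ∑' x, f x :=
  Equiv.tsum_eq (Equiv.addRight v) f

lemma cap_pt (hd : 3 ≤ d) {A B : Set (Zd d)} (v x : Zd d) (hsub : {y | y + v ∈ B} ⊆ A)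
    (hx : x ∈ A) (hz : x + v ∈ B) : W.eqm A x ≤ W.eqm B (x + v) := by
  rw [← eqm_translate W hd, eqm_lap W hd, eqm_lap W hd, kl_mem W hd A x hx,
    kl_mem W hd {y | y + v ∈ B} x hz]
  have := Pop_mono (fun y => kl_mono W hd hsub (subset_refl univ) y) x
  linarith

lemma cap_cover_aux (hd : 3 ≤ d) {ι : Type} [Fintype ι] {A B : Set (Zd d)} (hAf : A.Finite)
    (hBf : B.Finite) (v : ι → Zd d) (hsub : ∀ z, {y | y + v z ∈ B} ⊆ A)
    (hcov : ∀ x ∈ A, ∃ z, x + v z ∈ B) : W.cap A ≤ (Fintype.card ι : ℝ) * W.cap B := by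
  have hpt : ∀ x, W.eqm A x ≤ ∑ z, W.eqm B (x + v z) := by
    intro x
    by_cases hx : x ∈ A
    · obtain ⟨z, hz⟩ := hcov x hx
      have h1 := cap_pt W hd (v z) x (hsub z) hx hz
      exact h1.trans (Finset.single_le_sum (f := fun z => W.eqm B (x + v z))
        (fun z _ => eqm_nonneg W B _) (Finset.mem_univ z))
    · have : W.eqm A x = 0 := by simp [SRW.eqm, hx]
      rw [this]; exact Finset.sum_nonneg fun z _ => eqm_nonneg W B _
  have hs : ∀ z, Summable fun x => W.eqm B (x + v z) := fun z =>
    summable_shift (v z) (W.eqm B) (eqm_summable W hBf)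
  rw [cap_tsum W hAf, cap_tsum W hBf]
  refine (Summable.tsum_le_tsum hpt (eqm_summable W hAf) (summable_sum fun z _ => hs z)).trans ?_
  rw [Summable.tsum_finsetSum fun z _ => hs z]
  have : ∀ z, ∑' x, W.eqm B (x + v z) = ∑' x, W.eqm B x := fun z =>
    tsum_shift (v z) (W.eqm B)
  rw [Finset.sum_congr rfl fun z _ => this z, Finset.sum_const, nsmul_eq_mul, Finset.card_univ]

lemma cap_cover (hd : 3 ≤ d) (L : ℕ) (hL : 1 ≤ L) :
    W.cap (intBox (-(4 * L : ℤ)) (5 * L)) ≤ 9 ^ d * W.cap (intBox 0 (L : ℤ)) := by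
  set B : Set (Zd d) := intBox 0 (L : ℤ) with hB
  set A : Set (Zd d) := intBox (-(4 * L : ℤ)) (5 * L) with hA
  have hBf : B.Finite := intBox_finite _ _
  have hAf : A.Finite := intBox_finite _ _
  let v : (Fin d → Fin 9) → Zd d := fun z i => -((L : ℤ) * ((z i : ℕ) - 4))
  have hsub : ∀ z, {y | y + v z ∈ B} ⊆ A := by
    intro z y hy i
    have h := hy i
    have hz := (z i).2
    have hz' : ((z i : ℕ) : ℤ) ≤ 8 := by omega
    have hz0 : (0 : ℤ) ≤ ((z i : ℕ) : ℤ) := by omega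
    simp only [Pi.add_apply, v] at h
    have hL' : (0 : ℤ) ≤ L := by omega
    have h1 := mul_le_mul_of_nonneg_left hz' hL'
    have h2 := mul_nonneg hL' hz0
    constructor <;> nlinarith [h.1, h.2]
  have hcov : ∀ x ∈ A, ∃ z, x + v z ∈ B := by
    intro x hx
    have hL' : (0 : ℤ) < L := by omega
    have hq : ∀ i, -4 ≤ x i / L ∧ x i / L < 5 := by
      intro i
      have := hx i
      constructor
      · rw [Int.le_ediv_iff_mul_le hL']; linarith [this.1]
      · rw [Int.ediv_lt_iff_lt_mul hL']; linarith [this.2]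
    refine ⟨fun i => ⟨(x i / L + 4).toNat, by have := hq i; omega⟩, fun i => ?_⟩
    have h1 : (((x i / L + 4).toNat : ℕ) : ℤ) = x i / L + 4 := Int.toNat_of_nonneg (by
      have := hq i; omega)
    simp only [Pi.add_apply, v, h1]
    have h2 := Int.emod_add_mul_ediv (x i) L
    have h3 := Int.emod_nonneg (x i) hL'.ne'
    have h4 := Int.emod_lt_of_pos (x i) hL'
    constructor <;> linarith
  have h := cap_cover_aux W hd hAf hBf v hsub hcov
  have hc : (Fintype.card (Fin d → Fin 9) : ℝ) = 9 ^ d := by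
    rw [Fintype.card_fun, Fintype.card_fin, Fintype.card_fin]; push_cast; rfl
  rw [hc] at h
  exact h

lemma Pinit_eq {A : Set (Zd d)} (hA : A.Finite) (D U : Set (Zd d)) :
    (W.Pinit (W.ebar A) {ω | W.hit D ω < W.exit U ω}).toReal =
      ∑' x, W.ebar A x * kl W D U x := by
  have hcap : 0 ≤ W.cap A := by rw [cap_tsum W hA]; exact tsum_nonneg (eqm_nonneg W A)
  have h0 : ∀ x, 0 ≤ W.ebar A x := fun x => div_nonneg (eqm_nonneg W A x) hcap
  unfold SRW.Pinit
  rw [Measure.sum_apply_of_countable, ENNReal.tsum_toReal_eq]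
  · refine tsum_congr fun x => ?_
    rw [Measure.smul_apply, smul_eq_mul, ENNReal.toReal_mul, ENNReal.toReal_ofReal (h0 x),
      P_hit_exit]
  · intro x
    have := W.isProb x
    rw [Measure.smul_apply, smul_eq_mul]
    exact ENNReal.mul_ne_top ENNReal.ofReal_ne_top (measure_ne_top _ _)

lemma far_bound (hd : 3 ≤ d) {a : ℝ} (ha : 1 ≤ a)
    (hsup : ∀ x : Zd d, Pop (sh d a) x ≤ sh d a x) (L K : ℕ) (hL : 1 ≤ L) (hK : 100 ≤ K)
    (D : Set (Zd d)) (hD : D ⊆ intBox (-(3 * L : ℤ)) (4 * L)) (n : ℕ) (x : Zd d)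
    (hx : x ∉ (intBox (-(((K : ℤ) + 1) * L) + 1) (((K : ℤ) + 1) * L - 1) : Set (Zd d))) :
    kk D univ n x ≤ (16 * d + a) ^ (((d : ℝ) - 2) / 2) / (K : ℝ) ^ (d - 2) := by
  have hd' : (3 : ℝ) ≤ d := by exact_mod_cast hd
  have hα : 0 < ((d : ℝ) - 2) / 2 := by linarith
  have hL' : (1 : ℝ) ≤ L := by exact_mod_cast hL
  have hK' : (100 : ℝ) ≤ K := by exact_mod_cast hK
  have hL2 : (1 : ℝ) ≤ (L : ℝ) ^ 2 := one_le_pow₀ hL'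
  have hm : 0 < ((16 * d + a) * (L : ℝ) ^ 2) ^ (-(((d : ℝ) - 2) / 2)) := by positivity
  refine (kk_sh ha hsup D univ _ hm ?_ n x).trans ?_
  · intro y hy
    unfold sh
    have hn : nsq y ≤ d * (16 * (L : ℝ) ^ 2) := by
      unfold nsq
      refine (Finset.sum_le_card_nsmul _ _ (16 * (L : ℝ) ^ 2) fun i _ => ?_).trans (by simp)
      have := hD hy i
      have h1 : -(3 * (L : ℝ)) ≤ y i := by exact_mod_cast this.1
      have h2 : (y i : ℝ) < 4 * L := by exact_mod_cast this.2
      nlinarith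
    refine Real.rpow_le_rpow_of_nonpos (by linarith [nsq_nonneg y]) ?_ (by linarith)
    nlinarith
  · have hbig : ((K : ℝ) ^ 2) * (L : ℝ) ^ 2 ≤ nsq x + a := by
      have : ∃ i, ((K : ℤ) * L) ^ 2 ≤ (x i) ^ 2 := by
        by_contra hcon
        push Not at hcon
        refine hx fun i => ?_
        have h1 := abs_lt_of_sq_lt_sq (hcon i) (by positivity)
        rw [abs_lt] at h1
        have : (1 : ℤ) ≤ L := by exact_mod_cast hL
        constructor <;> nlinarith [h1.1, h1.2]
      obtain ⟨i, hi⟩ := this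
      have hi' : ((K : ℝ) * L) ^ 2 ≤ (x i : ℝ) ^ 2 := by exact_mod_cast hi
      have := sq_le_nsq x i
      rw [← mul_pow]; linarith
    have hsx : sh d a x ≤ ((K : ℝ) ^ 2 * (L : ℝ) ^ 2) ^ (-(((d : ℝ) - 2) / 2)) :=
      Real.rpow_le_rpow_of_nonpos (by positivity) hbig (by linarith)
    refine (mul_le_mul_of_nonneg_left hsx (inv_pos.2 hm).le).trans (le_of_eq ?_)
    have hKp : ((K : ℝ) ^ 2) ^ (((d : ℝ) - 2) / 2) = (K : ℝ) ^ (d - 2) := by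
      rw [← Real.rpow_natCast (K : ℝ) 2, ← Real.rpow_mul (by positivity),
        ← Real.rpow_natCast (K : ℝ) (d - 2)]
      congr 1
      push_cast [show 2 ≤ d by omega]; ring
    rw [← hKp, Real.rpow_neg (by positivity), Real.rpow_neg (by positivity), inv_inv,
      Real.mul_rpow (by positivity) (by positivity), Real.mul_rpow (by positivity) (by positivity)]
    have : (0:ℝ) < ((L : ℝ) ^ 2) ^ (((d : ℝ) - 2) / 2) := by positivity
    field_simp

end final

end Disc12

/-- Lemma 4.2: with `D = D₀`, `Ď = ℤ^d ∩ [−4L,5L)^d` and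
`Ǔ = ℤ^d ∩ [−(K+1)L+1,(K+1)L−1)^d`,
`cap(D)/cap(Ď) ≥ P_{ē_Ď}[H_D < T_Ǔ] ≥ cap(D)/cap(Ď) − c/K^{d−2}
≥ (cap(D)/cap(Ď))(1 − c'/K^{d−2})`. -/
theorem statement12 {d : ℕ} (hd : 3 ≤ d) {Ω : Type*} [MeasurableSpace Ω] (W : SRW d Ω) :
    ∃ c c' : ℝ, 0 < c ∧ 0 < c' ∧
      ∀ (L K : ℕ), 1 ≤ L → c ≤ (K : ℝ) → 100 ≤ K →
        ∀ D₀ : Set (Zd d), isBox D₀ →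
          (intBox 0 (L : ℤ) : Set (Zd d)) ⊆ D₀ → D₀ ⊆ intBox (-(3 * L : ℤ)) (4 * L) →
          (W.Pinit (W.ebar (intBox (-(4 * L : ℤ)) (5 * L)))
              {ω | W.hit D₀ ω <
                W.exit (intBox (-(((K : ℤ) + 1) * L) + 1) (((K : ℤ) + 1) * L - 1)) ω}).toReal
            ≤ W.cap D₀ / W.cap (intBox (-(4 * L : ℤ)) (5 * L)) ∧
          W.cap D₀ / W.cap (intBox (-(4 * L : ℤ)) (5 * L)) - c / (K : ℝ) ^ (d - 2)
            ≤ (W.Pinit (W.ebar (intBox (-(4 * L : ℤ)) (5 * L)))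
                {ω | W.hit D₀ ω <
                  W.exit (intBox (-(((K : ℤ) + 1) * L) + 1) (((K : ℤ) + 1) * L - 1)) ω}).toReal ∧
          (W.cap D₀ / W.cap (intBox (-(4 * L : ℤ)) (5 * L))) * (1 - c' / (K : ℝ) ^ (d - 2))
            ≤ W.cap D₀ / W.cap (intBox (-(4 * L : ℤ)) (5 * L)) - c / (K : ℝ) ^ (d - 2) := by
  obtain ⟨a, ha, hsup⟩ := Disc12.exists_sh hd
  have hd0 : (0 : ℝ) < d := by positivity
  set c : ℝ := (16 * d + a) ^ (((d : ℝ) - 2) / 2) with hc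
  have hc0 : 0 < c := by positivity
  refine ⟨c, c * 9 ^ d, hc0, by positivity, ?_⟩
  intro L K hL _ hK D hbox hsub1 hsub2
  set A : Set (Zd d) := intBox (-(4 * L : ℤ)) (5 * L) with hA
  set U : Set (Zd d) := intBox (-(((K : ℤ) + 1) * L) + 1) (((K : ℤ) + 1) * L - 1) with hU
  have hAf : A.Finite := Disc12.intBox_finite _ _
  have hDf : D.Finite := (Disc12.intBox_finite _ _).subset hsub2
  have hBf : (intBox 0 (L : ℤ) : Set (Zd d)).Finite := Disc12.intBox_finite _ _
  have hBne : (intBox 0 (L : ℤ) : Set (Zd d)).Nonempty :=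
    ⟨fun _ => 0, fun i => ⟨le_refl _, by show (0:ℤ) < (L:ℤ); omega⟩⟩
  have hDA : D ⊆ A := by
    intro x hx i
    have := hsub2 hx i
    constructor <;> omega
  have hcB := Disc12.cap_pos W hd hBf hBne
  have hBD := Disc12.cap_mono W hd hBf hDf hsub1
  have hcov := Disc12.cap_cover W hd L hL
  have hDAcap := Disc12.cap_mono W hd hDf hAf hDA
  have hcA : 0 < W.cap A := by linarith
  have hKpos : (0 : ℝ) < (K : ℝ) ^ (d - 2) := by
    have : (100 : ℝ) ≤ K := by exact_mod_cast hK
    positivity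
  have hsum : ∀ f : Zd d → ℝ, Summable fun x => W.ebar A x * f x := by
    intro f
    refine Disc12.summ_fin ((Disc12.eqm_supp W hAf).subset fun x hx h => hx ?_) f
    simp [SRW.ebar, h]
  have hsw : ∑' x, W.ebar A x * Disc12.kl W D univ x = W.cap D / W.cap A := by
    rw [← Disc12.sweep W hd hDf hAf hDA, ← tsum_div_const]
    refine tsum_congr fun x => ?_
    simp only [SRW.ebar]; ring
  have hone : ∑' x, W.ebar A x = 1 := by
    have : W.ebar A = fun x => W.eqm A x / W.cap A := rfl
    rw [this, tsum_div_const, ← Disc12.cap_tsum W hAf, div_self hcA.ne']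
  have he0 : ∀ x, 0 ≤ W.ebar A x := fun x => div_nonneg (Disc12.eqm_nonneg W A x) hcA.le
  rw [Disc12.Pinit_eq W hAf D U, ← hsw]
  refine ⟨?_, ?_, ?_⟩
  · exact Summable.tsum_le_tsum (fun x => mul_le_mul_of_nonneg_left
      (Disc12.kl_mono W hd (subset_refl D) (subset_univ U) x) (he0 x)) (hsum _) (hsum _)
  · set ε := c / (K : ℝ) ^ (d - 2) with hε
    have hε0 : 0 ≤ ε := by positivity
    have hk : ∀ x, Disc12.kl W D univ x ≤ Disc12.kl W D U x + ε := fun x =>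
      le_of_tendsto_of_tendsto' (Disc12.kl_tendsto W hd D univ x)
        ((Disc12.kl_tendsto W hd D U x).add_const ε)
        fun n => Disc12.kk_univ_le hd D U ε hε0
          (fun n x hx => Disc12.far_bound hd ha hsup L K hL hK D hsub2 n x hx) n x
    have h1 : ∑' x, W.ebar A x * Disc12.kl W D univ x ≤
        ∑' x, W.ebar A x * (Disc12.kl W D U x + ε) :=
      Summable.tsum_le_tsum (fun x => mul_le_mul_of_nonneg_left (hk x) (he0 x)) (hsum _) (hsum _)
    simp_rw [mul_add] at h1
    rw [Summable.tsum_add (hsum _) (hsum _), tsum_mul_right, hone, one_mul] at h1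
    linarith
  · rw [hsw]
    have hr : 1 ≤ W.cap D / W.cap A * 9 ^ d := by
      rw [div_mul_eq_mul_div, le_div_iff₀ hcA, one_mul]
      have h9 : (0 : ℝ) < 9 ^ d := by positivity
      nlinarith
    have h2 : c / (K : ℝ) ^ (d - 2) ≤ W.cap D / W.cap A * (c * 9 ^ d / (K : ℝ) ^ (d - 2)) := by
      have h3 : 0 ≤ c / (K : ℝ) ^ (d - 2) := by positivity
      calc c / (K : ℝ) ^ (d - 2) = 1 * (c / (K : ℝ) ^ (d - 2)) := by ring
        _ ≤ (W.cap D / W.cap A * 9 ^ d) * (c / (K : ℝ) ^ (d - 2)) := by gcongr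
        _ = _ := by ring
    linarith
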